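/- For k ≥ 4 let Γ = ⟨γ⟩ be cyclic of order k. Let 2 ≤ j ≤ k−2 and let (G,ψ) be a ℤ_k^j-gain tight Γ-gain graph with a free vertex v of degree 3, such that v has no loop and exactly one neighbour u. Then there is an admissible 1-reduction at v. -/

import Mathlib

open scoped Classical

namespace GR

/-- A finite directed multigraph with edge labels ("gains") in a group `Γ` and a
designated finite set of fixed vertices. -/
structure GainedGraph (V E Γ : Type) where
  tail : E → V
  head : E → V
  gain : E → Γ
  fixed : Finset V

variable {V E Γ : Type} [DecidableEq V] [DecidableEq E] [Fintype V] [Fintype E] [Group Γ]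

/-- A subgraph: a set of vertices and a set of edges whose endpoints lie in the vertex set. -/
structure Subgraph (G : GainedGraph V E Γ) where
  verts : Finset V
  edges : Finset E
  tail_mem : ∀ e ∈ edges, G.tail e ∈ verts
  head_mem : ∀ e ∈ edges, G.head e ∈ verts

namespace Subgraph

variable {G : GainedGraph V E Γ}

instance : Top (Subgraph G) :=
  ⟨⟨Finset.univ, Finset.univ, fun _ _ => Finset.mem_univ _, fun _ _ => Finset.mem_univ _⟩⟩

instance : LE (Subgraph G) :=
  ⟨fun H K => H.verts ⊆ K.verts ∧ H.edges ⊆ K.edges⟩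

def union (H K : Subgraph G) : Subgraph G where
  verts := H.verts ∪ K.verts
  edges := H.edges ∪ K.edges
  tail_mem e he := by
    rcases Finset.mem_union.1 he with h | h
    · exact Finset.mem_union_left _ (H.tail_mem e h)
    · exact Finset.mem_union_right _ (K.tail_mem e h)
  head_mem e he := by
    rcases Finset.mem_union.1 he with h | h
    · exact Finset.mem_union_left _ (H.head_mem e h)
    · exact Finset.mem_union_right _ (K.head_mem e h)

def inter (H K : Subgraph G) : Subgraph G where
  verts := H.verts ∩ K.verts
  edges := H.edges ∩ K.edges
  tail_mem e he := by
    rcases Finset.mem_inter.1 he with ⟨h1, h2⟩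
    exact Finset.mem_inter.2 ⟨H.tail_mem e h1, K.tail_mem e h2⟩
  head_mem e he := by
    rcases Finset.mem_inter.1 he with ⟨h1, h2⟩
    exact Finset.mem_inter.2 ⟨H.head_mem e h1, K.head_mem e h2⟩

/-- Delete a vertex together with all edges incident to it. -/
def deleteVertex (H : Subgraph G) (v : V) : Subgraph G where
  verts := H.verts.erase v
  edges := H.edges.filter fun e => G.tail e ≠ v ∧ G.head e ≠ v
  tail_mem e he := by
    rcases Finset.mem_filter.1 he with ⟨h1, h2, h3⟩
    exact Finset.mem_erase.2 ⟨h2, H.tail_mem e h1⟩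
  head_mem e he := by
    rcases Finset.mem_filter.1 he with ⟨h1, h2, h3⟩
    exact Finset.mem_erase.2 ⟨h3, H.head_mem e h1⟩

/-- Delete an edge. -/
def deleteEdge (H : Subgraph G) (f : E) : Subgraph G where
  verts := H.verts
  edges := H.edges.erase f
  tail_mem e he := H.tail_mem e (Finset.mem_of_mem_erase he)
  head_mem e he := H.head_mem e (Finset.mem_of_mem_erase he)

/-- Add an edge (together with its endpoints). -/
def addEdge (H : Subgraph G) (f : E) : Subgraph G where
  verts := insert (G.tail f) (insert (G.head f) H.verts)
  edges := insert f H.edges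
  tail_mem e he := by
    rcases Finset.mem_insert.1 he with rfl | h
    · exact Finset.mem_insert_self _ _
    · exact Finset.mem_insert_of_mem (Finset.mem_insert_of_mem (H.tail_mem e h))
  head_mem e he := by
    rcases Finset.mem_insert.1 he with rfl | h
    · exact Finset.mem_insert_of_mem (Finset.mem_insert_self _ _)
    · exact Finset.mem_insert_of_mem (Finset.mem_insert_of_mem (H.head_mem e h))

/-- The free vertices of a subgraph. -/
def freeVerts (H : Subgraph G) : Finset V := H.verts \ G.fixed

/-- The fixed vertices of a subgraph. -/
def fixedVerts (H : Subgraph G) : Finset V := H.verts ∩ G.fixed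

end Subgraph

/-- The starting vertex of an oriented traversal of an edge. -/
def stepStart (G : GainedGraph V E Γ) (s : E × Bool) : V :=
  if s.2 then G.tail s.1 else G.head s.1

/-- The ending vertex of an oriented traversal of an edge. -/
def stepEnd (G : GainedGraph V E Γ) (s : E × Bool) : V :=
  if s.2 then G.head s.1 else G.tail s.1

/-- The gain contributed by an oriented traversal of an edge. -/
def stepGain (G : GainedGraph V E Γ) (s : E × Bool) : Γ :=
  if s.2 then G.gain s.1 else (G.gain s.1)⁻¹

/-- `IsWalk G H L u w` : `L` is a walk in the subgraph `H` from `u` to `w`. -/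
def IsWalk (G : GainedGraph V E Γ) (H : Subgraph G) : List (E × Bool) → V → V → Prop
  | [], u, w => u = w ∧ u ∈ H.verts
  | s :: L, u, w => s.1 ∈ H.edges ∧ stepStart G s = u ∧ IsWalk G H L (stepEnd G s) w

/-- The gain of a walk. -/
def walkGain (G : GainedGraph V E Γ) (L : List (E × Bool)) : Γ :=
  (L.map (stepGain G)).prod

/-- The vertices visited by a walk starting at `u`. -/
def walkVerts (G : GainedGraph V E Γ) (u : V) (L : List (E × Bool)) : List V :=
  u :: L.map (stepEnd G)

/-- `⟨H⟩` : the subgroup of `Γ` generated by the gains of all closed walks in `H`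
containing no fixed vertex. -/
def gainGroup (G : GainedGraph V E Γ) (H : Subgraph G) : Subgroup Γ :=
  Subgroup.closure
    {g | ∃ u L, IsWalk G H L u u ∧ (∀ x ∈ walkVerts G u L, x ∉ G.fixed) ∧ walkGain G L = g}

/-- A subgraph is balanced if its gain group is trivial. -/
def Balanced (G : GainedGraph V E Γ) (H : Subgraph G) : Prop := gainGroup G H = ⊥

def Reachable (G : GainedGraph V E Γ) (H : Subgraph G) (u w : V) : Prop :=
  ∃ L, IsWalk G H L u w

def Connected (G : GainedGraph V E Γ) (H : Subgraph G) : Prop :=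
  H.verts.Nonempty ∧ ∀ u ∈ H.verts, ∀ w ∈ H.verts, Reachable G H u w

/-- `v` is a cut-vertex of the subgraph `H`. -/
def IsCutVertex (G : GainedGraph V E Γ) (H : Subgraph G) (v : V) : Prop :=
  v ∈ H.verts ∧ ∃ u ∈ H.verts, ∃ w ∈ H.verts, u ≠ v ∧ w ≠ v ∧
    Reachable G H u w ∧ ¬ Reachable G (H.deleteVertex v) u w

/-- `(2,m,l)`-sparsity of the subgraph `K`. -/
def Sparse (G : GainedGraph V E Γ) (m l : ℤ) (K : Subgraph G) : Prop :=
  ∀ H : Subgraph G, H ≤ K → H.edges.Nonempty →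
    (H.edges.card : ℤ) ≤ 2 * (H.freeVerts.card : ℤ) + m * (H.fixedVerts.card : ℤ) - l

/-- `(2,m,l)`-tightness of the subgraph `K`. -/
def Tight (G : GainedGraph V E Γ) (m l : ℤ) (K : Subgraph G) : Prop :=
  Sparse G m l K ∧
    (K.edges.card : ℤ) = 2 * (K.freeVerts.card : ℤ) + m * (K.fixedVerts.card : ℤ) - l

/-- `(2,m,3,l)`-gain-tightness: `(2,m,l)`-tight and every balanced subgraph with a
nonempty edge set is `(2,3)`-sparse. -/
def GainTight23 (G : GainedGraph V E Γ) (m l : ℤ) (K : Subgraph G) : Prop :=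
  Tight G m l K ∧ ∀ H : Subgraph G, H ≤ K → H.edges.Nonempty → Balanced G H →
    (H.edges.card : ℤ) ≤ 2 * (H.verts.card : ℤ) - 3

/-- The subgraph has no fixed vertex. -/
def NoFixed (G : GainedGraph V E Γ) (H : Subgraph G) : Prop :=
  ∀ x ∈ H.verts, x ∉ G.fixed

/-- Near-balanced with base vertex `v` and gain `δ`: unbalanced, and every closed
walk starting at `v` not containing `v` as an internal vertex has gain `1`, `δ` or `δ⁻¹`. -/
def NearBalancedAt (G : GainedGraph V E Γ) (H : Subgraph G) (v : V) (δ : Γ) : Prop :=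
  ¬ Balanced G H ∧ ∀ L, IsWalk G H L v v →
    (∀ x ∈ (L.map (stepEnd G)).dropLast, x ≠ v) → walkGain G L ∈ ({1, δ, δ⁻¹} : Set Γ)

def NearBalanced (G : GainedGraph V E Γ) (H : Subgraph G) : Prop :=
  NoFixed G H ∧ ∃ v ∈ H.verts, ∃ δ : Γ, NearBalancedAt G H v δ

/-- The gain group of `H` is isomorphic to `ℤ_n`. -/
def IsZIso (G : GainedGraph V E Γ) (H : Subgraph G) (n : ℕ) : Prop :=
  Nonempty (gainGroup G H ≃* Multiplicative (ZMod n))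

def ProperNearBalanced (G : GainedGraph V E Γ) (H : Subgraph G) : Prop :=
  NearBalanced G H ∧ ¬ IsZIso G H 2 ∧ ¬ IsZIso G H 3

/-- The set `S_i(k,j)`. -/
def SSet (k j : ℕ) (i : ℤ) : Set ℕ :=
  {n | 2 ≤ n ∧ n ∣ k ∧ (Odd j → n ≠ 2) ∧ ((j : ZMod n) = (i : ZMod n))}

/-- `H` is `S_i(k,j)`. -/
def IsS (G : GainedGraph V E Γ) (k j : ℕ) (i : ℤ) (H : Subgraph G) : Prop :=
  ∃ n ∈ SSet k j i, IsZIso G H n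

/-- `H` is `S_{±1}(k,j)`. -/
def IsSpm (G : GainedGraph V E Γ) (k j : ℕ) (H : Subgraph G) : Prop :=
  IsS G k j (-1) H ∨ IsS G k j 1 H

/-- The function `α_k^j` on (connected) subgraphs. -/
noncomputable def alpha (G : GainedGraph V E Γ) (k j : ℕ) (X : Subgraph G) : ℤ :=
  if Balanced G X then 0
  else if Odd j ∧ IsZIso G X 2 then 1
  else if IsSpm G k j X then 2 - (X.fixedVerts.card : ℤ)
  else if IsS G k j 0 X ∨ (X.fixedVerts.card = 0 ∧ ProperNearBalanced G X) then
    2 - 2 * (X.fixedVerts.card : ℤ)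
  else 3 - 2 * (X.fixedVerts.card : ℤ)

/-- The subgraph spanned by a set of edges. -/
def edgeSpan (G : GainedGraph V E Γ) (F : Finset E) : Subgraph G where
  verts := F.image G.tail ∪ F.image G.head
  edges := F
  tail_mem e he := Finset.mem_union_left _ (Finset.mem_image_of_mem _ he)
  head_mem e he := Finset.mem_union_right _ (Finset.mem_image_of_mem _ he)

/-- The connected component of the edge `e` in the subgraph spanned by `F`. -/
noncomputable def componentOf (G : GainedGraph V E Γ) (F : Finset E) (e : E) : Subgraph G :=
  edgeSpan G (F.filter fun f => Reachable G (edgeSpan G F) (G.tail e) (G.tail f))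

/-- The connected components of the edge set `F`. -/
noncomputable def components (G : GainedGraph V E Γ) (F : Finset E) : Finset (Subgraph G) :=
  F.image (componentOf G F)

/-- The count `f_k^j(F) = Σ_{X ∈ C(F)} (2|V(X)| − 3 + α_k^j(X))`. -/
noncomputable def fCount (G : GainedGraph V E Γ) (k j : ℕ) (F : Finset E) : ℤ :=
  ∑ X ∈ components G F, (2 * (X.verts.card : ℤ) - 3 + alpha G k j X)

/-- `ℤ_k^j`-gain sparsity. -/
def GainSparseKJ (G : GainedGraph V E Γ) (k j : ℕ) (K : Subgraph G) : Prop :=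
  ∀ H : Subgraph G, H ≤ K → H.edges.Nonempty → (H.edges.card : ℤ) ≤ fCount G k j H.edges

/-- `ℤ_k^j`-gain tightness. -/
def GainTightKJ (G : GainedGraph V E Γ) (k j : ℕ) (K : Subgraph G) : Prop :=
  GainSparseKJ G k j K ∧ (K.edges.card : ℤ) = fCount G k j K.edges

/-- The degree of a vertex in a subgraph (a loop counts twice). -/
def degree (G : GainedGraph V E Γ) (K : Subgraph G) (v : V) : ℕ :=
  (K.edges.filter fun e => G.tail e = v).card + (K.edges.filter fun e => G.head e = v).card

def HasLoopAt (G : GainedGraph V E Γ) (K : Subgraph G) (v : V) : Prop :=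
  ∃ e ∈ K.edges, G.tail e = v ∧ G.head e = v

/-- The neighbours of a vertex in a subgraph. -/
def neighbors (G : GainedGraph V E Γ) (K : Subgraph G) (v : V) : Finset V :=
  ((K.edges.filter fun e => G.tail e = v).image G.head) ∪
    ((K.edges.filter fun e => G.head e = v).image G.tail)

/-- The subgraph `K` satisfies the axioms of a `Γ`-gain graph. -/
structure IsGainGraphOn (G : GainedGraph V E Γ) (K : Subgraph G) : Prop where
  fixed_card : K.fixedVerts.card ≤ 1
  same_dir : ∀ e ∈ K.edges, ∀ f ∈ K.edges, e ≠ f → G.tail e = G.tail f →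
    G.head e = G.head f → G.gain e ≠ G.gain f
  opp_dir : ∀ e ∈ K.edges, ∀ f ∈ K.edges, e ≠ f → G.tail e = G.head f →
    G.head e = G.tail f → G.gain e ≠ (G.gain f)⁻¹
  fixed_not_loop : ∀ e ∈ K.edges, G.tail e = G.head e → G.tail e ∉ G.fixed
  fixed_not_parallel : ∀ e ∈ K.edges, ∀ f ∈ K.edges, e ≠ f →
    (G.tail e ∈ G.fixed ∨ G.head e ∈ G.fixed) →
    ({G.tail e, G.head e} : Finset V) ≠ {G.tail f, G.head f}
  loop_gain : ∀ e ∈ K.edges, G.tail e = G.head e → G.gain e ≠ 1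

/-- `H` together with the vertex `v` and all edges of `G₀` incident to `v`. -/
def addVertexEdges (G : GainedGraph V E Γ) (G₀ H : Subgraph G) (v : V) : Subgraph G where
  verts := (H.verts ∪ {v}) ∪
    ((G₀.edges.filter fun e => G.tail e = v ∨ G.head e = v).image G.tail ∪
      (G₀.edges.filter fun e => G.tail e = v ∨ G.head e = v).image G.head)
  edges := H.edges ∪ G₀.edges.filter fun e => G.tail e = v ∨ G.head e = v
  tail_mem e he := by
    rcases Finset.mem_union.1 he with h | h
    · exact Finset.mem_union_left _ (Finset.mem_union_left _ (H.tail_mem e h))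
    · exact Finset.mem_union_right _ (Finset.mem_union_left _ (Finset.mem_image_of_mem _ h))
  head_mem e he := by
    rcases Finset.mem_union.1 he with h | h
    · exact Finset.mem_union_left _ (Finset.mem_union_left _ (H.head_mem e h))
    · exact Finset.mem_union_right _ (Finset.mem_union_right _ (Finset.mem_image_of_mem _ h))

/-- The result of a 1-reduction at `v` adding the edge `f`: delete `v` and all edges at
`v` and add the edge `f`. -/
def reduceAt (G : GainedGraph V E Γ) (G₀ : Subgraph G) (v : V) (f : E) : Subgraph G where
  verts := insert (G.tail f) (insert (G.head f) (G₀.verts.erase v))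
  edges := insert f (G₀.edges.filter fun e => G.tail e ≠ v ∧ G.head e ≠ v)
  tail_mem e he := by
    rcases Finset.mem_insert.1 he with rfl | h
    · exact Finset.mem_insert_self _ _
    · rcases Finset.mem_filter.1 h with ⟨h1, h2, h3⟩
      exact Finset.mem_insert_of_mem
        (Finset.mem_insert_of_mem (Finset.mem_erase.2 ⟨h2, G₀.tail_mem e h1⟩))
  head_mem e he := by
    rcases Finset.mem_insert.1 he with rfl | h
    · exact Finset.mem_insert_of_mem (Finset.mem_insert_self _ _)
    · rcases Finset.mem_filter.1 h with ⟨h1, h2, h3⟩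
      exact Finset.mem_insert_of_mem
        (Finset.mem_insert_of_mem (Finset.mem_erase.2 ⟨h3, G₀.head_mem e h1⟩))

/-- The new edge `f` arises from a 1-reduction at the vertex `v` of `G₀`: its endpoints are
joined to `v` by two distinct edges of `G₀` and its gain is the gain of the corresponding
path of length two through `v`. -/
def IsOneReduction (G : GainedGraph V E Γ) (G₀ : Subgraph G) (v : V) (f : E) : Prop :=
  f ∉ G₀.edges ∧ G.tail f ≠ v ∧ G.head f ≠ v ∧
    ∃ s₁ s₂ : E × Bool, s₁.1 ∈ G₀.edges ∧ s₂.1 ∈ G₀.edges ∧ s₁.1 ≠ s₂.1 ∧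
      stepEnd G s₁ = v ∧ stepStart G s₂ = v ∧
      G.tail f = stepStart G s₁ ∧ G.head f = stepEnd G s₂ ∧
      G.gain f = stepGain G s₁ * stepGain G s₂

/-- Two labelled edges coincide (up to reorientation with gain inversion). -/
def SameEdge (G : GainedGraph V E Γ) (e f : E) : Prop :=
  (G.tail e = G.tail f ∧ G.head e = G.head f ∧ G.gain e = G.gain f) ∨
    (G.tail e = G.head f ∧ G.head e = G.tail f ∧ G.gain e = (G.gain f)⁻¹)

/-- `H` is a blocker of the 1-reduction at `v` adding the edge `f`. -/
def IsBlocker (G : GainedGraph V E Γ) (k j : ℕ) (G₀ : Subgraph G) (v : V) (f : E)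
    (H : Subgraph G) : Prop :=
  H ≤ G₀ ∧ v ∉ H.verts ∧ G.tail f ∈ H.verts ∧ G.head f ∈ H.verts ∧ H.edges.Nonempty ∧
    Connected G (H.addEdge f) ∧
    (H.edges.card : ℤ) = 2 * (H.verts.card : ℤ) - 3 + alpha G k j (H.addEdge f)

/-- The graph `G` extended by one fresh edge `none` with tail `t`, head `h` and gain `g`. -/
def extendGraph (G : GainedGraph V E Γ) (t h : V) (g : Γ) : GainedGraph V (Option E) Γ where
  tail e := e.elim t G.tail
  head e := e.elim h G.head
  gain e := e.elim g G.gain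
  fixed := G.fixed

/-- The whole original graph `G`, viewed inside the extension. -/
def extendTop (G : GainedGraph V E Γ) (t h : V) (g : Γ) : Subgraph (extendGraph G t h g) where
  verts := Finset.univ
  edges := Finset.univ.image Option.some
  tail_mem _ _ := Finset.mem_univ _
  head_mem _ _ := Finset.mem_univ _

/-- There is an admissible 1-reduction at `v`, i.e. a choice of new edge (with
endpoints and gain coming from a path of length two through `v`) such that the
resulting `Γ`-gain graph is well defined and `ℤ_k^j`-gain tight. -/
def AdmissibleOneReductionExists (G : GainedGraph V E Γ) (k j : ℕ) (v : V) : Prop :=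
  ∃ t h : V, ∃ g : Γ,
    IsOneReduction (extendGraph G t h g) (extendTop G t h g) v none ∧
    IsGainGraphOn (extendGraph G t h g)
      (reduceAt (extendGraph G t h g) (extendTop G t h g) v none) ∧
    GainTightKJ (extendGraph G t h g) k j
      (reduceAt (extendGraph G t h g) (extendTop G t h g) v none)

end GR

namespace GR

section Walks

variable {V E Γ : Type} {G : GainedGraph V E Γ} {H K : Subgraph G}

/-- The same edge traversed in the opposite direction. -/
def flipStep (s : E × Bool) : E × Bool := (s.1, !s.2)

@[simp] theorem stepStart_flipStep (s : E × Bool) : stepStart G (flipStep s) = stepEnd G s := by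
  rcases s with ⟨e, _ | _⟩ <;> rfl

@[simp] theorem stepEnd_flipStep (s : E × Bool) : stepEnd G (flipStep s) = stepStart G s := by
  rcases s with ⟨e, _ | _⟩ <;> rfl

theorem stepStart_mem {s : E × Bool} (hs : s.1 ∈ H.edges) : stepStart G s ∈ H.verts := by
  rcases s with ⟨e, _ | _⟩
  · exact H.head_mem e hs
  · exact H.tail_mem e hs

theorem stepEnd_mem {s : E × Bool} (hs : s.1 ∈ H.edges) : stepEnd G s ∈ H.verts := by
  rcases s with ⟨e, _ | _⟩
  · exact H.tail_mem e hs
  · exact H.head_mem e hs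

theorem IsWalk.left_mem {L : List (E × Bool)} {u w : V} (h : IsWalk G H L u w) :
    u ∈ H.verts := by
  cases L with
  | nil => exact h.2
  | cons s L => exact h.2.1 ▸ stepStart_mem h.1

theorem IsWalk.right_mem {L : List (E × Bool)} {u w : V} (h : IsWalk G H L u w) :
    w ∈ H.verts := by
  induction L generalizing u with
  | nil => exact h.1 ▸ h.2
  | cons s L ih => exact ih h.2.2

theorem IsWalk.append {L M : List (E × Bool)} {u w x : V} (hL : IsWalk G H L u w)
    (hM : IsWalk G H M w x) : IsWalk G H (L ++ M) u x := by
  induction L generalizing u with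
  | nil => obtain ⟨rfl, -⟩ := hL; exact hM
  | cons s L ih => exact ⟨hL.1, hL.2.1, ih hL.2.2⟩

theorem IsWalk.mono {L : List (E × Bool)} {u w : V} (h : IsWalk G H L u w) (hHK : H ≤ K) :
    IsWalk G K L u w := by
  induction L generalizing u with
  | nil => exact ⟨h.1, hHK.1 h.2⟩
  | cons s L ih => exact ⟨hHK.2 h.1, h.2.1, ih h.2.2⟩

theorem isWalk_singleton {s : E × Bool} (hs : s.1 ∈ H.edges) :
    IsWalk G H [s] (stepStart G s) (stepEnd G s) :=
  ⟨hs, rfl, rfl, stepEnd_mem hs⟩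

/-- The walk traversed backwards. -/
def reverseWalk (L : List (E × Bool)) : List (E × Bool) := (L.map flipStep).reverse

theorem IsWalk.reverse {L : List (E × Bool)} {u w : V} (h : IsWalk G H L u w) :
    IsWalk G H (reverseWalk L) w u := by
  induction L generalizing u with
  | nil => exact ⟨h.1.symm, h.1 ▸ h.2⟩
  | cons s L ih =>
    simp only [reverseWalk, List.map_cons, List.reverse_cons]
    exact (ih h.2.2).append ⟨h.1, by simp, by simpa using h.2.1,
      by simpa using stepStart_mem h.1⟩

theorem IsWalk.mem_walkVerts_of_reverse {L : List (E × Bool)} {u w : V} (h : IsWalk G H L u w) :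
    ∀ x ∈ walkVerts G w (reverseWalk L), x ∈ walkVerts G u L := by
  induction L generalizing u with
  | nil => obtain ⟨rfl, -⟩ := h; simp [reverseWalk]
  | cons s L ih =>
    have hv := ih h.2.2
    intro x hx
    have h' := h.2.1
    simp only [walkVerts, reverseWalk, List.map_append, List.mem_cons, List.mem_append,
      List.map_cons, List.map_nil, List.not_mem_nil, or_false, stepEnd_flipStep,
      List.reverse_cons] at hx hv ⊢
    rcases hx with rfl | hx | hx
    · exact Or.inr (hv _ (Or.inl rfl))
    · exact Or.inr (hv _ (Or.inr hx))
    · exact Or.inl (hx.trans h')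

theorem walkVerts_append {u w : V} {L M : List (E × Bool)} (P : V → Prop)
    (hL : ∀ x ∈ walkVerts G u L, P x) (hM : ∀ x ∈ walkVerts G w M, P x) :
    ∀ x ∈ walkVerts G u (L ++ M), P x := by
  intro x hx
  simp only [walkVerts, List.map_append, List.mem_cons, List.mem_append] at hx hL hM
  rcases hx with hx | hx | hx
  · exact hL x (Or.inl hx)
  · exact hL x (Or.inr hx)
  · exact hM x (Or.inr hx)

theorem Reachable.refl {u : V} (hu : u ∈ H.verts) : Reachable G H u u := ⟨[], rfl, hu⟩

theorem Reachable.symm {u w : V} (h : Reachable G H u w) : Reachable G H w u := by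
  obtain ⟨L, hL⟩ := h
  exact ⟨_, hL.reverse⟩

theorem Reachable.trans {u w x : V} (h : Reachable G H u w) (h' : Reachable G H w x) :
    Reachable G H u x := by
  obtain ⟨L, hL⟩ := h
  obtain ⟨M, hM⟩ := h'
  exact ⟨L ++ M, hL.append hM⟩

theorem Reachable.mono {u w : V} (h : Reachable G H u w) (hHK : H ≤ K) : Reachable G K u w :=
  let ⟨L, hL⟩ := h; ⟨L, hL.mono hHK⟩

theorem Reachable.right_mem {u w : V} (h : Reachable G H u w) : w ∈ H.verts :=
  let ⟨_, hL⟩ := h; hL.right_mem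

theorem reachable_of_edge {e : E} (he : e ∈ H.edges) : Reachable G H (G.tail e) (G.head e) :=
  ⟨[(e, true)], isWalk_singleton (s := (e, true)) he⟩

/-- A walk either avoids `w` after its start, or has a final segment from `w` doing so. -/
theorem IsWalk.exists_suffix_avoiding {L : List (E × Bool)} {x u w : V}
    (h : IsWalk G H L x u) :
    (∀ y ∈ L.map (stepEnd G), y ≠ w) ∨
      ∃ P, IsWalk G H P w u ∧ ∀ y ∈ P.map (stepEnd G), y ≠ w := by
  induction L generalizing x with
  | nil => exact Or.inl (by simp)
  | cons s L ih =>
    rcases ih h.2.2 with h1 | h1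
    · by_cases hs : stepEnd G s = w
      · exact Or.inr ⟨L, hs ▸ h.2.2, h1⟩
      · left
        intro y hy
        rcases List.mem_cons.1 hy with rfl | hy
        · exact hs
        · exact h1 y hy
    · exact Or.inr h1

/-- `x` and `y` are joined by a walk in `H` through free vertices. -/
def FreeReachable (H : Subgraph G) (x y : V) : Prop :=
  ∃ L, IsWalk G H L x y ∧ ∀ z ∈ walkVerts G x L, z ∉ G.fixed

theorem FreeReachable.symm {x y : V} (h : FreeReachable H x y) : FreeReachable H y x := by
  obtain ⟨L, hL, hf⟩ := h
  exact ⟨_, hL.reverse, fun z hz => hf z (hL.mem_walkVerts_of_reverse z hz)⟩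

theorem FreeReachable.trans {x y z : V} (h : FreeReachable H x y) (h' : FreeReachable H y z) :
    FreeReachable H x z := by
  obtain ⟨L, hL, hf⟩ := h
  obtain ⟨M, hM, hf'⟩ := h'
  exact ⟨L ++ M, hL.append hM, walkVerts_append _ hf hf'⟩

theorem NoFixed.walkVerts_notMem (h : NoFixed G H) {L : List (E × Bool)} {u w : V}
    (hL : IsWalk G H L u w) : ∀ x ∈ walkVerts G u L, x ∉ G.fixed := by
  induction L generalizing u with
  | nil => simpa [walkVerts] using h u hL.2
  | cons s L ih =>
    intro x hx
    rcases List.mem_cons.1 hx with rfl | hx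
    · exact h _ hL.left_mem
    · exact ih hL.2.2 x hx

end Walks

section Gains

variable {V E Γ : Type} [Group Γ] {G : GainedGraph V E Γ}

@[simp] theorem stepGain_flipStep (s : E × Bool) :
    stepGain G (flipStep s) = (stepGain G s)⁻¹ := by
  rcases s with ⟨e, _ | _⟩ <;> simp [flipStep, stepGain]

@[simp] theorem walkGain_nil : walkGain G [] = 1 := rfl

@[simp] theorem walkGain_cons (s : E × Bool) (L : List (E × Bool)) :
    walkGain G (s :: L) = stepGain G s * walkGain G L := by
  simp [walkGain]

@[simp] theorem walkGain_append (L M : List (E × Bool)) :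
    walkGain G (L ++ M) = walkGain G L * walkGain G M := by
  simp [walkGain]

@[simp] theorem walkGain_reverseWalk (L : List (E × Bool)) :
    walkGain G (reverseWalk L) = (walkGain G L)⁻¹ := by
  induction L with
  | nil => simp [reverseWalk]
  | cons s L ih => simpa [reverseWalk] using ih

end Gains

section Lollipop

variable {V E Γ : Type} [CommGroup Γ] {G : GainedGraph V E Γ} {H K : Subgraph G}

theorem exists_closed_walk_conj_of_ne {P Q : List (E × Bool)} {x u w : V}
    (hP : IsWalk G H P x u) (hPw : ∀ y ∈ P.map (stepEnd G), y ≠ w) (hx : x ≠ w)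
    (hQ : IsWalk G H Q u u) (hQw : ∀ y ∈ Q.map (stepEnd G), y ≠ w) :
    ∃ L, IsWalk G H L x x ∧ (∀ y ∈ L.map (stepEnd G), y ≠ w) ∧
      walkGain G L = walkGain G Q := by
  induction P generalizing x with
  | nil => obtain ⟨rfl, -⟩ := hP; exact ⟨Q, hQ, hQw, rfl⟩
  | cons s P ih =>
    have hsw : stepEnd G s ≠ w := hPw _ (by simp)
    obtain ⟨L, hL, hLw, hg⟩ := ih hP.2.2 (fun y hy => hPw y (List.mem_cons_of_mem _ hy)) hsw
    refine ⟨s :: (L ++ [flipStep s]), ⟨hP.1, hP.2.1,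
      hL.append ⟨hP.1, by simp, by simpa using hP.2.1, by simpa using stepStart_mem hP.1⟩⟩, ?_, ?_⟩
    · intro y hy
      simp only [List.map_cons, List.map_append, List.mem_cons, List.mem_append, List.map_nil,
        List.not_mem_nil, or_false, stepEnd_flipStep] at hy
      rcases hy with rfl | hy | rfl
      · exact hsw
      · exact hLw y hy
      · rw [hP.2.1]; exact hx
    · simp [hg]

/-- A closed walk at `u` avoiding `w ≠ u` can be turned into a first-return walk at `w` with
the same gain, provided `u` and `w` are connected. -/
theorem exists_first_return_conj {Q : List (E × Bool)} {u w : V} (hr : Reachable G H w u)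
    (hwu : u ≠ w) (hQ : IsWalk G H Q u u) (hQw : ∀ y ∈ Q.map (stepEnd G), y ≠ w) :
    ∃ L, IsWalk G H L w w ∧ (∀ y ∈ (L.map (stepEnd G)).dropLast, y ≠ w) ∧
      walkGain G L = walkGain G Q := by
  obtain ⟨P, hP, hPw⟩ : ∃ P, IsWalk G H P w u ∧ ∀ y ∈ P.map (stepEnd G), y ≠ w := by
    obtain ⟨P, hP⟩ := hr
    rcases hP.exists_suffix_avoiding (w := w) with h | h
    · exact ⟨P, hP, h⟩
    · exact h
  cases P with
  | nil => exact absurd hP.1.symm hwu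
  | cons s P =>
    have hsw : stepEnd G s ≠ w := hPw _ (by simp)
    obtain ⟨L, hL, hLw, hg⟩ := exists_closed_walk_conj_of_ne hP.2.2
      (fun y hy => hPw y (List.mem_cons_of_mem _ hy)) hsw hQ hQw
    refine ⟨(s :: L) ++ [flipStep s], ?_, ?_, by simp [hg]⟩
    · exact ⟨hP.1, hP.2.1,
        hL.append ⟨hP.1, by simp, by simpa using hP.2.1, by simpa using stepStart_mem hP.1⟩⟩
    · intro y hy
      rw [List.map_append, List.map_singleton, List.dropLast_concat] at hy
      rcases List.mem_cons.1 hy with rfl | hy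
      · exact hsw
      · exact hLw y hy

theorem walkGain_mem_of_first_return {S : Subgroup Γ} {w : V}
    (h : ∀ L, IsWalk G H L w w → (∀ y ∈ (L.map (stepEnd G)).dropLast, y ≠ w) →
      walkGain G L ∈ S)
    {L : List (E × Bool)} (hL : IsWalk G H L w w) : walkGain G L ∈ S := by
  suffices key : ∀ (L Q : List (E × Bool)) (x : V), IsWalk G H L x w → IsWalk G H Q w x →
      (∀ y ∈ Q.map (stepEnd G), y ≠ w) → walkGain G Q * walkGain G L ∈ S by
    simpa using key L [] w hL ⟨rfl, hL.left_mem⟩ (by simp)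
  intro L
  induction L with
  | nil =>
    intro Q x hL hQ hQw
    obtain ⟨rfl, -⟩ := hL
    simpa using h Q hQ fun y hy => hQw y (List.mem_of_mem_dropLast hy)
  | cons s L ih =>
    intro Q x hL hQ hQw
    have hQ' : IsWalk G H (Q ++ [s]) w (stepEnd G s) :=
      hQ.append ⟨hL.1, hL.2.1, rfl, stepEnd_mem hL.1⟩
    by_cases hs : stepEnd G s = w
    · have h1 := h (Q ++ [s]) (hs ▸ hQ') (by
        rw [List.map_append, List.map_singleton, List.dropLast_concat]; exact hQw)
      have h2 := ih [] w (hs ▸ hL.2.2) ⟨rfl, hs ▸ stepEnd_mem hL.1⟩ (by simp)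
      simpa [mul_assoc] using S.mul_mem h1 h2
    · have := ih (Q ++ [s]) _ hL.2.2 hQ' (by
        intro y hy
        simp only [List.map_append, List.mem_append, List.map_cons, List.map_nil,
          List.mem_singleton] at hy
        rcases hy with hy | rfl
        · exact hQw y hy
        · exact hs)
      simpa [mul_assoc] using this

end Lollipop

section Potential

variable {V E Γ : Type} [CommGroup Γ] {G : GainedGraph V E Γ} {H K : Subgraph G}

/-- The gain group is contained in `S` iff the gains are, modulo `S`, a coboundary on the free
vertices. -/
theorem gainGroup_le_iff {S : Subgroup Γ} :
    gainGroup G H ≤ S ↔ ∃ φ : V → Γ, ∀ e ∈ H.edges, G.tail e ∉ G.fixed → G.head e ∉ G.fixed →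
      φ (G.tail e) * G.gain e * (φ (G.head e))⁻¹ ∈ S := by
  constructor
  · intro hS
    have hex : ∃ r : V → V, (∀ x y, FreeReachable H x y → r x = r y) ∧
        ∀ x y, FreeReachable H x y → FreeReachable H (r x) x := by
      have hch : ∀ (p q : V → Prop) (hp : ∃ z, p z) (hq : ∃ z, q z), p = q →
          hp.choose = hq.choose := by
        rintro p _ hp hq rfl
        rfl
      refine ⟨fun x => if h : ∃ z, FreeReachable H x z then h.choose else x, ?_, ?_⟩
      · intro x y hxy
        have hs : (fun z => FreeReachable H x z) = fun z => FreeReachable H y z := by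
          funext z
          exact propext ⟨fun h => hxy.symm.trans h, fun h => hxy.trans h⟩
        have h1 : ∃ z, FreeReachable H x z := ⟨y, hxy⟩
        have h2 : ∃ z, FreeReachable H y z := ⟨x, hxy.symm⟩
        simp only [dif_pos h1, dif_pos h2]
        exact hch _ _ h1 h2 hs
      · intro x y hxy
        have h1 : ∃ z, FreeReachable H x z := ⟨y, hxy⟩
        simp only [dif_pos h1]
        exact h1.choose_spec.symm
    obtain ⟨r, hr, hr'⟩ := hex
    have hφ : ∀ x, ∃ g : Γ, (∃ y, FreeReachable H x y) →
        ∃ L, IsWalk G H L (r x) x ∧ (∀ z ∈ walkVerts G (r x) L, z ∉ G.fixed) ∧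
          walkGain G L = g := by
      intro x
      by_cases h : ∃ y, FreeReachable H x y
      · obtain ⟨y, hy⟩ := h
        obtain ⟨L, hL, hf⟩ := hr' x y hy
        exact ⟨walkGain G L, fun _ => ⟨L, hL, hf, rfl⟩⟩
      · exact ⟨1, fun h' => absurd h' h⟩
    choose φ hφ using hφ
    refine ⟨φ, fun e he ht hh => ?_⟩
    have hth : FreeReachable H (G.tail e) (G.head e) :=
      ⟨[(e, true)], isWalk_singleton (s := (e, true)) he, by
        simp [walkVerts, stepEnd, ht, hh]⟩
    obtain ⟨L, hL, hLf, hLg⟩ := hφ _ ⟨_, hth⟩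
    obtain ⟨M, hM, hMf, hMg⟩ := hφ _ ⟨_, hth.symm⟩
    rw [← hr _ _ hth] at hM hMf
    apply hS
    apply Subgroup.subset_closure
    refine ⟨_, L ++ ([(e, true)] ++ reverseWalk M),
      hL.append ((isWalk_singleton (s := (e, true)) he).append hM.reverse),
      walkVerts_append _ hLf (w := G.tail e) (walkVerts_append _ (w := G.head e) ?_
        fun z hz => hMf z (hM.mem_walkVerts_of_reverse z hz)), ?_⟩
    · simp [walkVerts, stepEnd, ht, hh]
    · simp [hLg, hMg, stepGain, mul_assoc]
  · rintro ⟨φ, hφ⟩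
    have key : ∀ (L : List (E × Bool)) (u w : V), IsWalk G H L u w →
        (∀ x ∈ walkVerts G u L, x ∉ G.fixed) → φ u * walkGain G L * (φ w)⁻¹ ∈ S := by
      intro L
      induction L with
      | nil => rintro u w ⟨rfl, -⟩ -; simp
      | cons s L ih =>
        intro u w h hf
        have h1 := ih _ _ h.2.2 (fun x hx => hf x (List.mem_cons_of_mem _ hx))
        have hu : u ∉ G.fixed := hf u (by simp [walkVerts])
        have hs : stepEnd G s ∉ G.fixed := hf _ (by simp [walkVerts])
        have h2 : φ u * stepGain G s * (φ (stepEnd G s))⁻¹ ∈ S := by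
          obtain ⟨he, rfl, -⟩ := h
          rcases s with ⟨e, _ | _⟩
          · simpa [stepStart, stepEnd, stepGain, mul_comm, mul_assoc, mul_left_comm] using
              S.inv_mem (hφ e he hs hu)
          · exact hφ e he hu hs
        convert S.mul_mem h2 h1 using 1
        simp [mul_assoc]
    rw [gainGroup, Subgroup.closure_le]
    rintro g ⟨u, L, hL, hf, rfl⟩
    have := key L u u hL hf
    rwa [mul_right_comm, mul_inv_cancel, one_mul] at this

theorem gainGroup_mono (h : H ≤ K) : gainGroup G H ≤ gainGroup G K := by
  apply Subgroup.closure_mono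
  rintro g ⟨u, L, hL, hf, hg⟩
  exact ⟨u, L, hL.mono h, hf, hg⟩

theorem walkGain_mem_gainGroup (h : NoFixed G H) {L : List (E × Bool)} {u : V}
    (hL : IsWalk G H L u u) : walkGain G L ∈ gainGroup G H :=
  Subgroup.subset_closure ⟨u, L, hL, h.walkVerts_notMem hL, rfl⟩

theorem gainGroup_le_of_first_return (hc : Connected G H) {S : Subgroup Γ} {w : V}
    (hw : w ∈ H.verts)
    (h : ∀ L, IsWalk G H L w w → (∀ y ∈ (L.map (stepEnd G)).dropLast, y ≠ w) →
      walkGain G L ∈ S) : gainGroup G H ≤ S := by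
  rw [gainGroup, Subgroup.closure_le]
  rintro g ⟨u, L, hL, -, rfl⟩
  obtain ⟨P, hP⟩ := hc.2 w hw u hL.left_mem
  have := walkGain_mem_of_first_return h (hP.append (hL.append hP.reverse))
  simpa [mul_comm, mul_left_comm] using this

end Potential

section Components

variable {V E Γ : Type} {G : GainedGraph V E Γ} {H K : Subgraph G}

theorem Subgraph.ext_of_eq (hv : H.verts = K.verts) (he : H.edges = K.edges) : H = K := by
  cases H; cases K; simp_all

theorem Subgraph.le_refl (H : Subgraph G) : H ≤ H := ⟨subset_rfl, subset_rfl⟩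

theorem Subgraph.le_trans {L : Subgraph G} (hHK : H ≤ K) (hKL : K ≤ L) : H ≤ L :=
  ⟨hHK.1.trans hKL.1, hHK.2.trans hKL.2⟩

/-- The connected component of `u` in the subgraph `H`. -/
noncomputable def comp (H : Subgraph G) (u : V) : Subgraph G where
  verts := H.verts.filter fun x => Reachable G H u x
  edges := H.edges.filter fun e => Reachable G H u (G.tail e)
  tail_mem e he := by
    rw [Finset.mem_filter] at he ⊢
    exact ⟨H.tail_mem e he.1, he.2⟩
  head_mem e he := by
    rw [Finset.mem_filter] at he ⊢
    exact ⟨H.head_mem e he.1, he.2.trans (reachable_of_edge he.1)⟩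

theorem mem_comp_verts {u x : V} : x ∈ (comp H u).verts ↔ Reachable G H u x := by
  simp only [comp, Finset.mem_filter, and_iff_right_iff_imp]
  exact fun h => h.right_mem

theorem mem_comp_edges {u : V} {e : E} :
    e ∈ (comp H u).edges ↔ e ∈ H.edges ∧ Reachable G H u (G.tail e) := by
  simp [comp]

theorem comp_le (H : Subgraph G) (u : V) : comp H u ≤ H :=
  ⟨Finset.filter_subset _ _, Finset.filter_subset _ _⟩

theorem IsWalk.comp {u x y : V} {L : List (E × Bool)} (hx : Reachable G H u x)
    (hL : IsWalk G H L x y) : IsWalk G (comp H u) L x y := by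
  induction L generalizing x with
  | nil => exact ⟨hL.1, mem_comp_verts.2 hx⟩
  | cons s L ih =>
    obtain ⟨he, rfl, hL⟩ := hL
    refine ⟨mem_comp_edges.2 ⟨he, ?_⟩, rfl, ih ?_ hL⟩
    · rcases s with ⟨e, _ | _⟩
      · exact hx.trans (reachable_of_edge he).symm
      · exact hx
    · exact hx.trans ⟨[s], isWalk_singleton he⟩

theorem connected_of_forall_reachable {u : V} (hu : u ∈ H.verts)
    (h : ∀ x ∈ H.verts, Reachable G H u x) : Connected G H :=
  ⟨⟨u, hu⟩, fun x hx y hy => (h x hx).symm.trans (h y hy)⟩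

theorem comp_connected {u : V} (hu : u ∈ H.verts) : Connected G (comp H u) := by
  refine connected_of_forall_reachable (mem_comp_verts.2 (Reachable.refl hu)) fun x hx => ?_
  obtain ⟨L, hL⟩ := mem_comp_verts.1 hx
  exact ⟨L, hL.comp (Reachable.refl hu)⟩

theorem tail_notMem_comp {u : V} {e : E} (he : e ∈ H.edges) (hne : e ∉ (comp H u).edges) :
    G.tail e ∉ (comp H u).verts := fun h =>
  hne (mem_comp_edges.2 ⟨he, mem_comp_verts.1 h⟩)

theorem head_notMem_comp {u : V} {e : E} (he : e ∈ H.edges) (hne : e ∉ (comp H u).edges) :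
    G.head e ∉ (comp H u).verts := fun h =>
  hne (mem_comp_edges.2 ⟨he, (mem_comp_verts.1 h).trans (reachable_of_edge he).symm⟩)

theorem Connected.verts_eq_singleton (hc : Connected G H) (he : H.edges = ∅) {u : V}
    (hu : u ∈ H.verts) : H.verts = {u} := by
  refine Finset.eq_singleton_iff_unique_mem.2 ⟨hu, fun x hx => ?_⟩
  obtain ⟨L, hL⟩ := hc.2 x hx u hu
  cases L with
  | nil => exact hL.1
  | cons s L => simpa [he] using hL.1

variable [DecidableEq V]

theorem Connected.eq_edgeSpan (hc : Connected G H) (hne : H.edges.Nonempty) :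
    H = edgeSpan G H.edges := by
  obtain ⟨e, he⟩ := hne
  refine Subgraph.ext_of_eq (Finset.Subset.antisymm (fun x hx => ?_) fun x hx => ?_) rfl
  · obtain ⟨L, hL⟩ := hc.2 x hx _ (H.tail_mem e he)
    cases L with
    | nil => obtain ⟨rfl, -⟩ := hL; exact (edgeSpan G H.edges).tail_mem e he
    | cons s L =>
      obtain ⟨hs, rfl, -⟩ := hL
      exact stepStart_mem (H := edgeSpan G H.edges) hs
  · simp only [edgeSpan, Finset.mem_union, Finset.mem_image] at hx
    rcases hx with ⟨a, ha, rfl⟩ | ⟨a, ha, rfl⟩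
    · exact H.tail_mem a ha
    · exact H.head_mem a ha

theorem edgeSpan_le (H : Subgraph G) : edgeSpan G H.edges ≤ H := by
  refine ⟨fun x hx => ?_, subset_rfl⟩
  simp only [edgeSpan, Finset.mem_union, Finset.mem_image] at hx
  rcases hx with ⟨a, ha, rfl⟩ | ⟨a, ha, rfl⟩
  · exact H.tail_mem a ha
  · exact H.head_mem a ha

theorem edgeSpan_mono {A B : Finset E} (h : A ⊆ B) : edgeSpan G A ≤ edgeSpan G B :=
  ⟨Finset.union_subset_union (Finset.image_subset_image h) (Finset.image_subset_image h), h⟩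

theorem edgeSpan_union_verts [DecidableEq E] (A B : Finset E) :
    (edgeSpan G (A ∪ B)).verts = (edgeSpan G A).verts ∪ (edgeSpan G B).verts := by
  simp only [edgeSpan, Finset.image_union]
  ext x
  simp only [Finset.mem_union]
  tauto

theorem union_connected [DecidableEq E] (hH : Connected G H) (hK : Connected G K) {u : V}
    (hu : u ∈ H.verts) (hu' : u ∈ K.verts) : Connected G (H.union K) := by
  refine connected_of_forall_reachable (u := u) (Finset.mem_union_left _ hu) fun x hx => ?_
  rcases Finset.mem_union.1 hx with hx | hx
  · exact (hH.2 u hu x hx).mono ⟨Finset.subset_union_left, Finset.subset_union_left⟩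
  · exact (hK.2 u hu' x hx).mono ⟨Finset.subset_union_right, Finset.subset_union_right⟩

theorem IsWalk.of_disjoint [DecidableEq E] {A B : Finset E}
    (hd : Disjoint (edgeSpan G A).verts (edgeSpan G B).verts)
    {x y : V} {L : List (E × Bool)} (hx : x ∈ (edgeSpan G B).verts)
    (hL : IsWalk G (edgeSpan G (A ∪ B)) L x y) : IsWalk G (edgeSpan G B) L x y := by
  induction L generalizing x with
  | nil => exact ⟨hL.1, hx⟩
  | cons s L ih =>
    obtain ⟨he, rfl, hL⟩ := hL
    rcases Finset.mem_union.1 he with he | he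
    · exact absurd hx (Finset.disjoint_left.1 hd (stepStart_mem (H := edgeSpan G A) he))
    · exact ⟨he, rfl, ih (stepEnd_mem (H := edgeSpan G B) he) hL⟩

theorem componentOf_union [DecidableEq E] {A B : Finset E}
    (hd : Disjoint (edgeSpan G A).verts (edgeSpan G B).verts) {e : E} (he : e ∈ B) :
    componentOf G (A ∪ B) e = componentOf G B e := by
  unfold componentOf
  congr 1
  ext f
  have het : G.tail e ∈ (edgeSpan G B).verts := (edgeSpan G B).tail_mem e he
  simp only [Finset.mem_filter]
  constructor
  · rintro ⟨hf, L, hL⟩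
    have hL' := hL.of_disjoint hd het
    refine ⟨?_, L, hL'⟩
    rcases Finset.mem_union.1 hf with hf | hf
    · exact absurd hL'.right_mem (Finset.disjoint_left.1 hd ((edgeSpan G A).tail_mem f hf))
    · exact hf
  · rintro ⟨hf, hr⟩
    exact ⟨Finset.mem_union_right _ hf, hr.mono (edgeSpan_mono Finset.subset_union_right)⟩

theorem componentOf_edges_subset (F : Finset E) (e : E) : (componentOf G F e).edges ⊆ F :=
  Finset.filter_subset _ _

theorem mem_componentOf {F : Finset E} {e : E} (he : e ∈ F) : e ∈ (componentOf G F e).edges :=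
  Finset.mem_filter.2 ⟨he, Reachable.refl ((edgeSpan G F).tail_mem e he)⟩

theorem components_union [DecidableEq E] {A B : Finset E}
    (hd : Disjoint (edgeSpan G A).verts (edgeSpan G B).verts) :
    components G (A ∪ B) = components G A ∪ components G B := by
  unfold components
  rw [Finset.image_union]
  congr 1
  · refine Finset.image_congr fun e he => ?_
    rw [Finset.union_comm]
    exact componentOf_union hd.symm he
  · exact Finset.image_congr fun e he => componentOf_union hd he

theorem disjoint_of_disjoint_verts {A B : Finset E}
    (hd : Disjoint (edgeSpan G A).verts (edgeSpan G B).verts) : Disjoint A B :=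
  Finset.disjoint_left.2 fun e he he' =>
    Finset.disjoint_left.1 hd ((edgeSpan G A).tail_mem e he) ((edgeSpan G B).tail_mem e he')

theorem components_disjoint {A B : Finset E} (hd : Disjoint A B) :
    Disjoint (components G A) (components G B) := by
  rw [Finset.disjoint_left]
  intro X hX hX'
  obtain ⟨e, he, rfl⟩ := Finset.mem_image.1 hX
  obtain ⟨f, hf, hef⟩ := Finset.mem_image.1 hX'
  have h1 := mem_componentOf (G := G) he
  rw [← hef] at h1
  exact Finset.disjoint_left.1 hd he (componentOf_edges_subset _ _ h1)

theorem components_of_connected {F : Finset E} (hF : F.Nonempty)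
    (hc : Connected G (edgeSpan G F)) : components G F = {edgeSpan G F} := by
  have h : ∀ e ∈ F, componentOf G F e = edgeSpan G F := by
    intro e he
    unfold componentOf
    rw [Finset.filter_true_of_mem]
    exact fun f hf => hc.2 _ ((edgeSpan G F).tail_mem e he) _ ((edgeSpan G F).tail_mem f hf)
  ext X
  simp only [components, Finset.mem_image, Finset.mem_singleton]
  constructor
  · rintro ⟨e, he, rfl⟩
    exact h e he
  · rintro rfl
    obtain ⟨e, he⟩ := hF
    exact ⟨e, he, h e he⟩

/-- Induction on an edge set by splitting off one connected component at a time. -/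
theorem component_induction [DecidableEq E] {P : Finset E → Prop} (h0 : P ∅)
    (hstep : ∀ A B : Finset E, A.Nonempty → Connected G (edgeSpan G A) →
      Disjoint (edgeSpan G A).verts (edgeSpan G B).verts → P B → P (A ∪ B)) (F : Finset E) :
    P F := by
  induction F using Finset.strongInduction with
  | H F ih =>
    rcases F.eq_empty_or_nonempty with rfl | ⟨e, he⟩
    · exact h0
    set C := comp (edgeSpan G F) (G.tail e) with hC
    have htail : G.tail e ∈ (edgeSpan G F).verts := (edgeSpan G F).tail_mem e he
    have heC : e ∈ C.edges := mem_comp_edges.2 ⟨he, Reachable.refl htail⟩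
    have hCF : C.edges ⊆ F := (comp_le _ _).2
    have hCc : Connected G C := comp_connected htail
    have hCs : C = edgeSpan G C.edges := hCc.eq_edgeSpan ⟨e, heC⟩
    have := hstep C.edges (F \ C.edges) ⟨e, heC⟩ (hCs ▸ hCc) ?_
      (ih _ (Finset.sdiff_ssubset hCF ⟨e, heC⟩))
    · rwa [Finset.union_sdiff_of_subset hCF] at this
    · rw [← hCs, Finset.disjoint_right]
      intro x hx
      simp only [edgeSpan, Finset.mem_union, Finset.mem_image, Finset.mem_sdiff] at hx
      rcases hx with ⟨a, ⟨ha, ha'⟩, rfl⟩ | ⟨a, ⟨ha, ha'⟩, rfl⟩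
      · exact tail_notMem_comp (H := edgeSpan G F) ha ha'
      · exact head_notMem_comp (H := edgeSpan G F) ha ha'

end Components

section Count

variable {V E Γ : Type} [DecidableEq V] [DecidableEq E] [Group Γ] {G : GainedGraph V E Γ}
  {H K : Subgraph G} {k j : ℕ}

/-- The bound `2|V(X)| - 3 + α(X)` on the number of edges of a connected subgraph `X`. -/
noncomputable def connBound (G : GainedGraph V E Γ) (k j : ℕ) (X : Subgraph G) : ℤ :=
  2 * (X.verts.card : ℤ) - 3 + alpha G k j X

omit [DecidableEq E] in
theorem fCount_empty : fCount G k j ∅ = 0 := by simp [fCount, components]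

theorem fCount_union {A B : Finset E}
    (hd : Disjoint (edgeSpan G A).verts (edgeSpan G B).verts) :
    fCount G k j (A ∪ B) = fCount G k j A + fCount G k j B := by
  unfold fCount
  rw [components_union hd, Finset.sum_union (components_disjoint (disjoint_of_disjoint_verts hd))]

omit [DecidableEq E] in
theorem fCount_of_connected {F : Finset E} (hF : F.Nonempty)
    (hc : Connected G (edgeSpan G F)) : fCount G k j F = connBound G k j (edgeSpan G F) := by
  unfold fCount
  rw [components_of_connected hF hc, Finset.sum_singleton, connBound]

theorem gainSparseKJ_iff : GainSparseKJ G k j K ↔ ∀ H : Subgraph G, H ≤ K → Connected G H →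
    H.edges.Nonempty → (H.edges.card : ℤ) ≤ connBound G k j H := by
  constructor
  · intro h H hHK hc hne
    have h1 := h H hHK hne
    have h2 := hc.eq_edgeSpan hne
    rw [fCount_of_connected hne (h2 ▸ hc), ← h2] at h1
    exact h1
  · intro h H hHK _
    have key : ∀ F : Finset E, F ⊆ K.edges → (F.card : ℤ) ≤ fCount G k j F := by
      intro F
      induction F using component_induction (G := G) with
      | h0 => simp [fCount_empty]
      | hstep A B hA hc hd ih =>
        intro hAB
        have h1 := h (edgeSpan G A) (Subgraph.le_trans (edgeSpan_mono
          (Finset.subset_union_left.trans hAB)) (edgeSpan_le K)) hc hA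
        have h2 := ih (Finset.subset_union_right.trans hAB)
        rw [fCount_union hd, fCount_of_connected hA hc,
          Finset.card_union_of_disjoint (disjoint_of_disjoint_verts hd)]
        push_cast
        exact add_le_add h1 h2
    exact key _ hHK.2

omit [DecidableEq E] in
theorem alpha_le_three (X : Subgraph G) : alpha G k j X ≤ 3 := by
  unfold alpha
  split_ifs <;> omega

theorem GainSparseKJ.card_le (h : GainSparseKJ G k j K) (F : Finset E) (hF : F ⊆ K.edges) :
    F.card ≤ 2 * (edgeSpan G F).verts.card := by
  induction F using component_induction (G := G) with
  | h0 => simp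
  | hstep A B hA hc hd ih =>
    have h1 := gainSparseKJ_iff.1 h (edgeSpan G A) (Subgraph.le_trans (edgeSpan_mono
      (Finset.subset_union_left.trans hF)) (edgeSpan_le K)) hc hA
    have h2 := ih (Finset.subset_union_right.trans hF)
    have h3 := alpha_le_three (k := k) (j := j) (edgeSpan G A)
    rw [edgeSpan_union_verts, Finset.card_union_of_disjoint hd,
      Finset.card_union_of_disjoint (disjoint_of_disjoint_verts hd)]
    unfold connBound at h1
    have h4 : (edgeSpan G A).edges = A := rfl
    rw [h4] at h1
    omega

/-- `|E(H)| - (2|V(H)| - 3)`. -/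
def excess (H : Subgraph G) : ℤ := (H.edges.card : ℤ) - 2 * (H.verts.card : ℤ) + 3

omit [Group Γ] in
theorem excess_union_add_inter (H K : Subgraph G) :
    excess (H.union K) + excess (H.inter K) = excess H + excess K := by
  have h1 := Finset.card_union_add_card_inter H.verts K.verts
  have h2 := Finset.card_union_add_card_inter H.edges K.edges
  simp only [excess, Subgraph.union, Subgraph.inter]
  omega

theorem GainSparseKJ.excess_le_comp (h : GainSparseKJ G k j K) (hHK : H ≤ K) (u : V) :
    excess H ≤ excess (comp H u) := by
  have h1 := h.card_le (H.edges \ (comp H u).edges) (Finset.sdiff_subset.trans hHK.2)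
  have h2 : (edgeSpan G (H.edges \ (comp H u).edges)).verts ⊆ H.verts \ (comp H u).verts := by
    intro x hx
    simp only [edgeSpan, Finset.mem_union, Finset.mem_image, Finset.mem_sdiff] at hx
    rcases hx with ⟨a, ⟨ha, ha'⟩, rfl⟩ | ⟨a, ⟨ha, ha'⟩, rfl⟩
    · exact Finset.mem_sdiff.2 ⟨H.tail_mem a ha, tail_notMem_comp ha ha'⟩
    · exact Finset.mem_sdiff.2 ⟨H.head_mem a ha, head_notMem_comp ha ha'⟩
  have h3 := Finset.card_le_card h2
  rw [Finset.card_sdiff_of_subset (comp_le H u).1] at h3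
  rw [Finset.card_sdiff_of_subset (comp_le H u).2] at h1
  have h4 := Finset.card_le_card (comp_le H u).1
  have h5 := Finset.card_le_card (comp_le H u).2
  unfold excess
  omega

theorem GainSparseKJ.excess_le_alpha (h : GainSparseKJ G k j K) (hHK : H ≤ K)
    (hc : Connected G H) (hne : H.edges.Nonempty) : excess H ≤ alpha G k j H := by
  have := gainSparseKJ_iff.1 h H hHK hc hne
  unfold connBound at this
  unfold excess
  omega

omit [DecidableEq V] [DecidableEq E] [Group Γ] in
theorem Connected.edges_nonempty_of_one_lt_excess (hc : Connected G H) (h : 1 < excess H) :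
    H.edges.Nonempty := by
  by_contra hne
  rw [Finset.not_nonempty_iff_eq_empty] at hne
  obtain ⟨u, hu⟩ := hc.1
  have := hc.verts_eq_singleton hne hu
  simp [excess, hne, this] at h

end Count

section Cyclic

variable {Γ : Type} [CommGroup Γ]

/-- The subgroup of elements `x` with `x ^ m = 1`. -/
def powKer (Γ : Type) [CommGroup Γ] (m : ℤ) : Subgroup Γ := (zpowGroupHom m : Γ →* Γ).ker

theorem mem_powKer {m : ℤ} {x : Γ} : x ∈ powKer Γ m ↔ x ^ m = 1 := Iff.rfl

theorem zpow_eq_one_of_mem_powKer {a b c : ℤ} {x : Γ} (ha : x ∈ powKer Γ a)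
    (hb : x ∈ powKer Γ b) (p q : ℤ) (hc : c = p * a + q * b) : x ^ c = 1 := by
  rw [mem_powKer] at ha hb
  rw [hc, zpow_add, mul_comm p, mul_comm q, zpow_mul, zpow_mul, ha, hb]
  simp

theorem card_dvd_iff_le_powKer [IsCyclic Γ] [Finite Γ] (A : Subgroup Γ) (m : ℤ) :
    (Nat.card A : ℤ) ∣ m ↔ A ≤ powKer Γ m := by
  constructor
  · intro h x hx
    rw [mem_powKer, ← orderOf_dvd_iff_zpow_eq_one]
    exact (Int.natCast_dvd_natCast.2 (Subgroup.orderOf_dvd_natCard A hx)).trans h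
  · intro h
    obtain ⟨g, hg⟩ := IsCyclic.exists_generator (α := A)
    rw [← orderOf_eq_card_of_forall_mem_zpowers hg, ← Subgroup.orderOf_coe,
      orderOf_dvd_iff_zpow_eq_one]
    exact h g.2

theorem eq_bot_or_card_eq_two [IsCyclic Γ] [Finite Γ] {A : Subgroup Γ}
    (h : A ≤ powKer Γ 2) : A = ⊥ ∨ Nat.card A = 2 := by
  have h1 := (card_dvd_iff_le_powKer A 2).2 h
  have h2 : Nat.card A ∣ 2 := by exact_mod_cast h1
  rcases (Nat.dvd_prime Nat.prime_two).1 h2 with h | h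
  · exact Or.inl (Subgroup.card_eq_one.1 h)
  · exact Or.inr h

theorem eq_of_card_eq_two {A : Subgroup Γ} (h : Nat.card A = 2) {x y : Γ}
    (hx : x ∈ A) (hy : y ∈ A) (hx1 : x ≠ 1) (hy1 : y ≠ 1) : x = y := by
  obtain ⟨z, hz, hu⟩ := (Nat.card_eq_two_iff' (1 : A)).1 h
  have h1 := hu ⟨x, hx⟩ (by simpa [Subtype.ext_iff] using hx1)
  have h2 := hu ⟨y, hy⟩ (by simpa [Subtype.ext_iff] using hy1)
  exact congrArg Subtype.val (h1.trans h2.symm)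

theorem sq_eq_one_of_card_eq_two {A : Subgroup Γ} (h : Nat.card A = 2) {x : Γ}
    (hx : x ∈ A) : x ^ 2 = 1 := by
  rw [← orderOf_dvd_iff_pow_eq_one, ← h]
  exact Subgroup.orderOf_dvd_natCard A hx

theorem eq_of_sq_eq_one [IsCyclic Γ] [Finite Γ] {x y : Γ} (hx : x ^ 2 = 1)
    (hy : y ^ 2 = 1) (hx1 : x ≠ 1) (hy1 : y ≠ 1) : x = y := by
  have hx' : x ∈ powKer Γ 2 := by rw [mem_powKer]; exact_mod_cast hx
  have hy' : y ∈ powKer Γ 2 := by rw [mem_powKer]; exact_mod_cast hy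
  rcases eq_bot_or_card_eq_two (le_refl (powKer Γ 2)) with h | h
  · rw [h, Subgroup.mem_bot] at hx'
    exact absurd hx' hx1
  · exact eq_of_card_eq_two h hx' hy' hx1 hy1

theorem mem_powKer_of_pow_three {x : Γ} (hx : x ^ 3 = 1) (j : ℕ) :
    ∃ i : ℤ, -1 ≤ i ∧ i ≤ 1 ∧ x ∈ powKer Γ ((j : ℤ) - i) := by
  have h3 : x ^ (3 : ℤ) = 1 := by exact_mod_cast hx
  have key : ∀ i q : ℤ, (j : ℤ) - i = 3 * q → x ∈ powKer Γ ((j : ℤ) - i) := by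
    intro i q h
    rw [mem_powKer, h, zpow_mul, h3, one_zpow]
  rcases (by omega : (j : ℤ) % 3 = 0 ∨ (j : ℤ) % 3 = 1 ∨ (j : ℤ) % 3 = 2) with h | h | h
  · exact ⟨0, by omega, by omega, key 0 (j / 3) (by omega)⟩
  · exact ⟨1, by omega, by omega, key 1 (j / 3) (by omega)⟩
  · exact ⟨-1, by omega, by omega, key (-1) (j / 3 + 1) (by omega)⟩

theorem mem_powKer_of_pow_four {x : Γ} (hx : x ^ 4 = 1) {j : ℕ} (hj : Odd j) :
    ∃ i : ℤ, -1 ≤ i ∧ i ≤ 1 ∧ x ∈ powKer Γ ((j : ℤ) - i) := by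
  have h3 : x ^ (4 : ℤ) = 1 := by exact_mod_cast hx
  have key : ∀ i q : ℤ, (j : ℤ) - i = 4 * q → x ∈ powKer Γ ((j : ℤ) - i) := by
    intro i q h
    rw [mem_powKer, h, zpow_mul, h3, one_zpow]
  obtain ⟨m, rfl⟩ := hj
  rcases (by omega : (m : ℤ) % 2 = 0 ∨ (m : ℤ) % 2 = 1) with h | h
  · exact ⟨1, by omega, by omega, key 1 (m / 2) (by push_cast; omega)⟩
  · exact ⟨-1, by omega, by omega, key (-1) (m / 2 + 1) (by push_cast; omega)⟩

theorem mem_powKer_of_sq_of_even {x : Γ} (hx : x ^ 2 = 1) {j : ℕ} (hj : ¬ Odd j) :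
    x ∈ powKer Γ ((j : ℤ) - 0) := by
  obtain ⟨m, rfl⟩ := Nat.not_odd_iff_even.1 hj
  have h : x ^ (m + m) = 1 := by rw [← two_mul, pow_mul, hx, one_pow]
  rw [mem_powKer, sub_zero]
  exact_mod_cast h

theorem eq_bot_or_card_eq_two_of_le_powKer [IsCyclic Γ] [Finite Γ] {A : Subgroup Γ} {j : ℕ}
    {i i' : ℤ} (hi : -1 ≤ i) (hi1 : i ≤ 1) (hi' : -1 ≤ i') (hi1' : i' ≤ 1) (hne : i ≠ i')
    (h : A ≤ powKer Γ ((j : ℤ) - i)) (h' : A ≤ powKer Γ ((j : ℤ) - i')) :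
    A = ⊥ ∨ (Odd j ∧ Nat.card A = 2) := by
  by_cases hd : i - i' = 1 ∨ i - i' = -1
  · left
    rw [Subgroup.eq_bot_iff_forall]
    intro x hx
    rcases hd with hd | hd
    · simpa using zpow_eq_one_of_mem_powKer (c := 1) (h hx) (h' hx) (-1) 1 (by linarith)
    · simpa using zpow_eq_one_of_mem_powKer (c := 1) (h hx) (h' hx) 1 (-1) (by linarith)
  · have hd' : i - i' = 2 ∨ i - i' = -2 := by omega
    have h2 : A ≤ powKer Γ 2 := by
      intro x hx
      rcases hd' with hd | hd
      · exact zpow_eq_one_of_mem_powKer (h hx) (h' hx) (-1) 1 (by linarith)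
      · exact zpow_eq_one_of_mem_powKer (h hx) (h' hx) 1 (-1) (by linarith)
    by_cases hj : Odd j
    · exact (eq_bot_or_card_eq_two h2).imp_right fun h => ⟨hj, h⟩
    · left
      rw [Subgroup.eq_bot_iff_forall]
      intro x hx
      have h3 := mem_powKer_of_sq_of_even (x := x) (by exact_mod_cast mem_powKer.1 (h2 hx)) hj
      have hi0 : i = 1 ∨ i = -1 := by omega
      rcases hi0 with rfl | rfl
      · simpa using zpow_eq_one_of_mem_powKer (c := 1) (h hx) h3 (-1) 1 (by ring)
      · simpa using zpow_eq_one_of_mem_powKer (c := 1) (h hx) h3 1 (-1) (by ring)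

end Cyclic

section Alpha

variable {V E Γ : Type} [DecidableEq V] [CommGroup Γ] [IsCyclic Γ] [Finite Γ]
  {G : GainedGraph V E Γ} {H : Subgraph G} {k j : ℕ}

omit [DecidableEq V] [Finite Γ] in
theorem isZIso_iff {n : ℕ} : IsZIso G H n ↔ Nat.card (gainGroup G H) = n := by
  constructor
  · rintro ⟨f⟩
    rw [Nat.card_congr f.toEquiv, Nat.card_congr Multiplicative.toAdd, Nat.card_zmod]
  · intro h
    exact ⟨mulEquivOfCyclicCardEq
      (by rw [h, Nat.card_congr Multiplicative.toAdd, Nat.card_zmod])⟩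

omit [DecidableEq V] in
theorem isS_iff (hk : Nat.card Γ = k) {i : ℤ} : IsS G k j i H ↔ gainGroup G H ≠ ⊥ ∧
    ¬ (Odd j ∧ Nat.card (gainGroup G H) = 2) ∧ gainGroup G H ≤ powKer Γ ((j : ℤ) - i) := by
  have hpos : 0 < Nat.card (gainGroup G H) := Nat.card_pos
  have h1 : gainGroup G H ≠ ⊥ ↔ 2 ≤ Nat.card (gainGroup G H) := by
    have h := Subgroup.card_eq_one (H := gainGroup G H)
    rw [ne_eq, ← h]
    omega
  have hd : Nat.card (gainGroup G H) ∣ k := hk ▸ Subgroup.card_subgroup_dvd_card _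
  have h2 : ((j : ZMod (Nat.card (gainGroup G H))) = (i : ℤ)) ↔
      gainGroup G H ≤ powKer Γ ((j : ℤ) - i) := by
    rw [← card_dvd_iff_le_powKer, ← Int.cast_natCast j, eq_comm,
      ZMod.intCast_eq_intCast_iff_dvd_sub]
  simp only [IsS, SSet, isZIso_iff, Set.mem_ofPred_eq]
  rw [h1, ← h2]
  constructor
  · rintro ⟨n, ⟨ha, -, hc, hd⟩, rfl⟩
    exact ⟨ha, fun h => hc h.1 h.2, hd⟩
  · rintro ⟨ha, hb, hc⟩
    exact ⟨_, ⟨ha, hd, fun h1 h2 => hb ⟨h1, h2⟩, hc⟩, rfl⟩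

theorem alpha_eq (hk : Nat.card Γ = k) : alpha G k j H =
    if gainGroup G H = ⊥ then 0
    else if Odd j ∧ Nat.card (gainGroup G H) = 2 then 1
    else if gainGroup G H ≤ powKer Γ ((j : ℤ) - (-1)) ∨ gainGroup G H ≤ powKer Γ ((j : ℤ) - 1)
      then 2 - (H.fixedVerts.card : ℤ)
    else if gainGroup G H ≤ powKer Γ ((j : ℤ) - 0) ∨
      (H.fixedVerts.card = 0 ∧ ProperNearBalanced G H) then 2 - 2 * (H.fixedVerts.card : ℤ)
    else 3 - 2 * (H.fixedVerts.card : ℤ) := by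
  unfold alpha IsSpm
  simp only [Balanced, isZIso_iff, isS_iff hk]
  by_cases h1 : gainGroup G H = ⊥
  · simp only [if_pos h1]
  by_cases h2 : Odd j ∧ Nat.card (gainGroup G H) = 2
  · simp only [if_neg h1, if_pos h2]
  simp only [h1, h2, if_false, not_false_eq_true, true_and, ne_eq]

theorem gainGroup_of_two_le_alpha (hk : Nat.card Γ = k) (h : 2 ≤ alpha G k j H) :
    gainGroup G H ≠ ⊥ ∧ ¬ (Odd j ∧ Nat.card (gainGroup G H) = 2) := by
  rw [alpha_eq hk] at h
  constructor
  · intro h1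
    rw [if_pos h1] at h
    omega
  · intro h2
    rw [if_pos h2] at h
    split_ifs at h <;> omega

end Alpha

section Triple

variable {V E Γ : Type} [CommGroup Γ]

theorem gainGroup_le_iff_step {G : GainedGraph V E Γ} {H : Subgraph G} {S : Subgroup Γ} :
    gainGroup G H ≤ S ↔ ∃ φ : V → Γ, ∀ s : E × Bool, s.1 ∈ H.edges →
      stepStart G s ∉ G.fixed → stepEnd G s ∉ G.fixed →
      φ (stepStart G s) * stepGain G s * (φ (stepEnd G s))⁻¹ ∈ S := by
  rw [gainGroup_le_iff]
  constructor
  · rintro ⟨φ, hφ⟩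
    refine ⟨φ, ?_⟩
    rintro ⟨e, _ | _⟩ he hs hs'
    · simpa [stepStart, stepEnd, stepGain, mul_comm, mul_assoc, mul_left_comm] using
        S.inv_mem (hφ e he hs' hs)
    · exact hφ e he hs hs'
  · rintro ⟨φ, hφ⟩
    exact ⟨φ, fun e he ht hh => hφ (e, true) he ht hh⟩

/-- The edges incident to `v` are three distinct parallel edges joining it to `u`; `s i` is the
`i`-th of them traversed from `u` to `v`. -/
structure PendantTriple (G : GainedGraph V E Γ) (v u : V) (s : Fin 3 → E × Bool) : Prop where
  ne : u ≠ v
  base_free : u ∉ G.fixed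
  apex_free : v ∉ G.fixed
  start_eq : ∀ i, stepStart G (s i) = u
  end_eq : ∀ i, stepEnd G (s i) = v
  edge_inj : Function.Injective fun i => (s i).1
  gain_inj : Function.Injective fun i => stepGain G (s i)
  incident : ∀ e, G.tail e = v ∨ G.head e = v → ∃ i, e = (s i).1

/-- The gain of the closed walk that goes along `s p` and returns along `s q`. -/
def loopGain (G : GainedGraph V E Γ) (s : Fin 3 → E × Bool) (p q : Fin 3) : Γ :=
  stepGain G (s p) * (stepGain G (s q))⁻¹

theorem loopGain_mul (G : GainedGraph V E Γ) (s : Fin 3 → E × Bool) (p q r : Fin 3) :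
    loopGain G s p q * loopGain G s q r = loopGain G s p r := by
  simp [loopGain]

theorem loopGain_inv (G : GainedGraph V E Γ) (s : Fin 3 → E × Bool) (p q : Fin 3) :
    (loopGain G s p q)⁻¹ = loopGain G s q p := by
  simp [loopGain]

@[simp] theorem loopGain_self (G : GainedGraph V E Γ) (s : Fin 3 → E × Bool) (p : Fin 3) :
    loopGain G s p p = 1 := by
  simp [loopGain]

variable [DecidableEq V] [DecidableEq E] {G : GainedGraph V E Γ} {v u : V} {s : Fin 3 → E × Bool}

/-- The subgraph spanned by the three edges of a pendant triple. -/
def tripleSpan (G : GainedGraph V E Γ) (s : Fin 3 → E × Bool) : Subgraph G :=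
  edgeSpan G (Finset.univ.image fun i => (s i).1)

namespace PendantTriple

variable (h : PendantTriple G v u s)
include h

omit [DecidableEq V] [DecidableEq E] in
theorem loopGain_ne_one {p q : Fin 3} (hpq : p ≠ q) : loopGain G s p q ≠ 1 := fun h' =>
  hpq (h.gain_inj (mul_inv_eq_one.1 h'))

omit [DecidableEq V] [DecidableEq E] in
theorem tail_head (i : Fin 3) : (G.tail (s i).1 = u ∧ G.head (s i).1 = v) ∨
    (G.tail (s i).1 = v ∧ G.head (s i).1 = u) := by
  have h1 := h.start_eq i
  have h2 := h.end_eq i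
  rcases hs : s i with ⟨e, _ | _⟩ <;> rw [hs] at h1 h2
  · exact Or.inr ⟨h2, h1⟩
  · exact Or.inl ⟨h1, h2⟩

omit [CommGroup Γ] h in
theorem mem_tripleSpan_edges (i : Fin 3) : (s i).1 ∈ (tripleSpan G s).edges :=
  Finset.mem_image_of_mem (fun i => (s i).1) (Finset.mem_univ i)

theorem tripleSpan_verts : (tripleSpan G s).verts = {u, v} := by
  ext x
  simp only [tripleSpan, edgeSpan, Finset.mem_union, Finset.mem_image, Finset.mem_univ, true_and,
    exists_exists_eq_and, Finset.mem_insert, Finset.mem_singleton]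
  constructor
  · rintro (⟨i, rfl⟩ | ⟨i, rfl⟩) <;> rcases h.tail_head i with ⟨h1, h2⟩ | ⟨h1, h2⟩ <;> simp [h1, h2]
  · rcases h.tail_head 0 with ⟨h1, h2⟩ | ⟨h1, h2⟩
    · rintro (rfl | rfl)
      · exact Or.inl ⟨0, h1⟩
      · exact Or.inr ⟨0, h2⟩
    · rintro (rfl | rfl)
      · exact Or.inr ⟨0, h2⟩
      · exact Or.inl ⟨0, h1⟩

theorem tripleSpan_connected : Connected G (tripleSpan G s) := by
  refine connected_of_forall_reachable (u := u) (by simp [h.tripleSpan_verts]) fun x hx => ?_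
  rw [h.tripleSpan_verts, Finset.mem_insert, Finset.mem_singleton] at hx
  rcases hx with rfl | rfl
  · exact Reachable.refl (by simp [h.tripleSpan_verts])
  · refine ⟨[s 0], ?_⟩
    have := isWalk_singleton (G := G) (H := tripleSpan G s) (s := s 0) (mem_tripleSpan_edges 0)
    rwa [h.start_eq, h.end_eq] at this

theorem union_verts {X : Subgraph G} (hu : u ∈ X.verts) :
    (X.union (tripleSpan G s)).verts = insert v X.verts := by
  simp only [Subgraph.union, h.tripleSpan_verts]
  ext x
  simp only [Finset.mem_union, Finset.mem_insert, Finset.mem_singleton]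
  constructor
  · rintro (hx | rfl | rfl) <;> simp_all
  · tauto

theorem excess_union {X : Subgraph G} (hu : u ∈ X.verts) (hv : v ∉ X.verts) :
    excess (X.union (tripleSpan G s)) = excess X + 1 := by
  have hd : Disjoint X.edges (tripleSpan G s).edges := by
    rw [Finset.disjoint_right]
    intro e he hX
    obtain ⟨i, -, rfl⟩ := Finset.mem_image.1 he
    rcases h.tail_head i with ⟨h1, h2⟩ | ⟨h1, h2⟩
    · exact hv (h2 ▸ X.head_mem _ hX)
    · exact hv (h1 ▸ X.tail_mem _ hX)
  have h3 : (tripleSpan G s).edges.card = 3 := by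
    simp [tripleSpan, edgeSpan, Finset.card_image_of_injective _ h.edge_inj]
  have h4 : (X.union (tripleSpan G s)).edges.card = X.edges.card + 3 := by
    rw [← h3]; exact Finset.card_union_of_disjoint hd
  simp only [excess, h4, h.union_verts hu, Finset.card_insert_of_notMem hv]
  push_cast
  ring

theorem fixedVerts_union {X : Subgraph G} (hu : u ∈ X.verts) :
    (X.union (tripleSpan G s)).fixedVerts = X.fixedVerts := by
  simp only [Subgraph.fixedVerts, h.union_verts hu]
  rw [Finset.insert_inter_of_notMem h.apex_free]

theorem union_connected {X : Subgraph G} (hc : Connected G X) (hu : u ∈ X.verts) :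
    Connected G (X.union (tripleSpan G s)) :=
  GR.union_connected hc h.tripleSpan_connected hu (by simp [h.tripleSpan_verts])

theorem gainGroup_union_le_iff {X : Subgraph G} (hv : v ∉ X.verts) {S : Subgroup Γ} :
    gainGroup G (X.union (tripleSpan G s)) ≤ S ↔
      gainGroup G X ≤ S ∧ ∀ p q, loopGain G s p q ∈ S := by
  constructor
  · intro hS
    refine ⟨(gainGroup_mono ⟨Finset.subset_union_left, Finset.subset_union_left⟩).trans hS,
      fun p q => ?_⟩
    obtain ⟨φ, hφ⟩ := gainGroup_le_iff_step.1 hS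
    have key : ∀ i, φ u * stepGain G (s i) * (φ v)⁻¹ ∈ S := by
      intro i
      have := hφ (s i) (Finset.mem_union_right _ (mem_tripleSpan_edges i))
        (by rw [h.start_eq]; exact h.base_free) (by rw [h.end_eq]; exact h.apex_free)
      rwa [h.start_eq, h.end_eq] at this
    have h1 := S.mul_mem (key p) (S.inv_mem (key q))
    convert h1 using 1
    rw [loopGain, ← div_eq_mul_inv, ← div_eq_mul_inv, ← div_eq_mul_inv, ← div_eq_mul_inv,
      div_div_div_cancel_right, mul_div_mul_left_eq_div]
  · rintro ⟨hX, hK⟩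
    obtain ⟨φ, hφ⟩ := gainGroup_le_iff.1 hX
    refine gainGroup_le_iff_step.2 ⟨Function.update φ v (φ u * stepGain G (s 0)), ?_⟩
    suffices hstep : ∀ e ∈ (X.union (tripleSpan G s)).edges, ∃ b : Bool,
        stepStart G (e, b) ∉ G.fixed → stepEnd G (e, b) ∉ G.fixed →
        Function.update φ v (φ u * stepGain G (s 0)) (stepStart G (e, b)) * stepGain G (e, b) *
          (Function.update φ v (φ u * stepGain G (s 0)) (stepEnd G (e, b)))⁻¹ ∈ S by
      rintro ⟨e, b⟩ he hs hs'
      obtain ⟨b', hb'⟩ := hstep e he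
      by_cases hbb : b' = b
      · exact hbb ▸ hb' (hbb ▸ hs) (hbb ▸ hs')
      · have hfl : (e, b') = flipStep (e, b) := by
          cases b <;> cases b' <;> simp_all [flipStep]
        rw [hfl] at hb'
        have := S.inv_mem (hb' (by simpa using hs') (by simpa using hs))
        simpa [mul_comm, mul_assoc, mul_left_comm] using this
    intro e he
    rcases Finset.mem_union.1 he with he | he
    · refine ⟨true, fun ht hh => ?_⟩
      have h1 : G.tail e ≠ v := fun h' => hv (h' ▸ X.tail_mem e he)
      have h2 : G.head e ≠ v := fun h' => hv (h' ▸ X.head_mem e he)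
      simpa [stepStart, stepEnd, stepGain, Function.update_of_ne h1, Function.update_of_ne h2]
        using hφ e he ht hh
    · obtain ⟨i, -, rfl⟩ := Finset.mem_image.1 he
      refine ⟨(s i).2, fun _ _ => ?_⟩
      have hsi : ((s i).1, (s i).2) = s i := rfl
      rw [hsi, h.start_eq, h.end_eq, Function.update_of_ne h.ne, Function.update_self]
      convert hK i 0 using 1
      rw [loopGain, ← div_eq_mul_inv, ← div_eq_mul_inv, mul_div_mul_left_eq_div]

omit h [DecidableEq V] [DecidableEq E] in
theorem loopGain_mem_of_adjacent {S : Subgroup Γ} {p q r : Fin 3} (hpq : p ≠ q) (hqr : q ≠ r)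
    (hpr : p ≠ r) (h1 : loopGain G s p q ∈ S) (h2 : loopGain G s q r ∈ S) (a b : Fin 3) :
    loopGain G s a b ∈ S := by
  have key : ∀ c, loopGain G s q c ∈ S := by
    intro c
    rcases (by omega : c = p ∨ c = q ∨ c = r) with rfl | rfl | rfl
    · rw [← loopGain_inv]; exact S.inv_mem h1
    · simp
    · exact h2
  rw [← loopGain_mul G s a q b, ← loopGain_inv G s q a]
  exact S.mul_mem (S.inv_mem (key a)) (key b)

theorem exists_first_return_loopGain {Z : Subgraph G} (hZ : Connected G Z)
    (hK : tripleSpan G s ≤ Z) {w : V} (hw : w ∈ Z.verts) (p q : Fin 3) :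
    ∃ L, IsWalk G Z L w w ∧ (∀ y ∈ (L.map (stepEnd G)).dropLast, y ≠ w) ∧
      walkGain G L = loopGain G s p q := by
  have hu : u ∈ Z.verts := hK.1 (by simp [h.tripleSpan_verts])
  have hv : v ∈ Z.verts := hK.1 (by simp [h.tripleSpan_verts])
  have hp : ∀ i, (s i).1 ∈ Z.edges := fun i => hK.2 (mem_tripleSpan_edges i)
  have hQ : IsWalk G Z [s p, flipStep (s q)] u u :=
    ⟨hp p, h.start_eq p, hp q, by simp [h.end_eq], by simp [h.start_eq], by simpa [h.start_eq]⟩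
  by_cases hwv : w = v
  · subst hwv
    refine ⟨[flipStep (s q), s p], ⟨hp q, by simp [h.end_eq], hp p, by simp [h.start_eq],
      by simp [h.end_eq], by simpa [h.end_eq]⟩, ?_, ?_⟩
    · simpa [h.start_eq] using h.ne
    · simp [loopGain, mul_comm]
  by_cases hwu : w = u
  · subst hwu
    refine ⟨_, hQ, ?_, by simp [loopGain]⟩
    simpa [h.end_eq] using h.ne.symm
  · obtain ⟨L, hL, hLw, hg⟩ := exists_first_return_conj (hZ.2 w hw u hu) (Ne.symm hwu) hQ (by
      simpa [h.end_eq, h.start_eq] using ⟨Ne.symm hwv, Ne.symm hwu⟩)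
    exact ⟨L, hL, hLw, by simp [hg, loopGain]⟩

theorem not_properNearBalanced [IsCyclic Γ] {Z : Subgraph G} (hZ : Connected G Z)
    (hK : tripleSpan G s ≤ Z) : ¬ ProperNearBalanced G Z := by
  rintro ⟨⟨hfree, w, hw, δ, -, hnb⟩, -, h3⟩
  have key : ∀ p q, loopGain G s p q ∈ ({1, δ, δ⁻¹} : Set Γ) := by
    intro p q
    obtain ⟨L, hL, hLw, hg⟩ := h.exists_first_return_loopGain hZ hK hw p q
    exact hg ▸ hnb L hL hLw
  have h01 := h.loopGain_ne_one (p := 0) (q := 1) (by decide)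
  have h12 := h.loopGain_ne_one (p := 1) (q := 2) (by decide)
  have h02 := h.loopGain_ne_one (p := 0) (q := 2) (by decide)
  have hm := loopGain_mul G s 0 1 2
  have k01 := key 0 1
  have k12 := key 1 2
  have k02 := key 0 2
  simp only [Set.mem_insert_iff, Set.mem_singleton_iff, h01, h12, h02, false_or] at k01 k12 k02
  have hδ : δ ≠ 1 := by
    rintro rfl
    simp at k01
    exact h01 k01
  have hδ3 : δ ^ 3 = 1 := by
    rcases k01 with k01 | k01 <;> rcases k12 with k12 | k12 <;> rcases k02 with k02 | k02 <;>
      rw [k01, k12, k02] at hm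
    · exact absurd (by simpa using hm) hδ
    · rw [pow_succ, sq, hm, inv_mul_cancel]
    · simp_all
    · simp_all
    · simp_all
    · simp_all
    · have h' := congrArg (· * δ) hm
      simp only [inv_mul_cancel_right] at h'
      rw [pow_succ, sq, ← h', inv_mul_cancel]
    · exact absurd (by simpa using hm) hδ
  have hgrp : gainGroup G Z = Subgroup.zpowers δ := by
    apply le_antisymm
    · refine gainGroup_le_of_first_return hZ hw fun L hL hLw => ?_
      rcases hnb L hL hLw with hg | hg | hg <;> rw [hg]
      · exact Subgroup.one_mem _
      · exact Subgroup.mem_zpowers δ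
      · exact Subgroup.inv_mem _ (Subgroup.mem_zpowers δ)
    · rw [Subgroup.zpowers_le]
      obtain ⟨L, hL, hLw, hg⟩ := h.exists_first_return_loopGain hZ hK hw 0 1
      have := walkGain_mem_gainGroup hfree hL
      rw [hg] at this
      rcases k01 with k01 | k01 <;> rw [k01] at this
      · exact this
      · simpa using Subgroup.inv_mem _ this
  apply h3
  rw [isZIso_iff, hgrp, Nat.card_zpowers]
  exact orderOf_eq_prime hδ3 hδ

end PendantTriple

end Triple

section Blocked

variable {V E Γ : Type} [DecidableEq V] [CommGroup Γ] {G : GainedGraph V E Γ} {j : ℕ} {v u : V}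
  {X Y : Subgraph G} {x y : Γ}

/-- A connected subgraph containing `u` but not `v`. -/
structure Avoiding (v u : V) (X : Subgraph G) : Prop where
  conn : Connected G X
  base_mem : u ∈ X.verts
  apex_notMem : v ∉ X.verts

/-- The gain group of some dense connected subgraph at `u` obstructs a new loop of gain `x`. -/
def GroupBlocked (G : GainedGraph V E Γ) (j : ℕ) (v u : V) (x : Γ) : Prop :=
  ∃ (X : Subgraph G) (i : ℤ), Avoiding v u X ∧ (-1 ≤ i ∧ i ≤ 1) ∧ x ∈ powKer Γ ((j : ℤ) - i) ∧
    gainGroup G X ≤ powKer Γ ((j : ℤ) - i) ∧ (X.fixedVerts.card = 0 ∨ i = 0) ∧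
    2 - 2 * (X.fixedVerts.card : ℤ) ≤ excess X

/-- Near-balancedness of some dense connected subgraph at `u` obstructs a new loop of gain `x`. -/
def NearBlocked (G : GainedGraph V E Γ) (j : ℕ) (v u : V) (x : Γ) : Prop :=
  ∃ X : Subgraph G, Avoiding v u X ∧ X.fixedVerts.card = 0 ∧ 2 ≤ excess X ∧
    (∀ L, IsWalk G X L u u → (∀ y ∈ (L.map (stepEnd G)).dropLast, y ≠ u) →
      walkGain G L ∈ ({1, x, x⁻¹} : Set Γ)) ∧
    ∀ i : ℤ, -1 ≤ i → i ≤ 1 → x ∉ powKer Γ ((j : ℤ) - i)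

/-- There is an obstruction to adding a loop of gain `x` at `u` after deleting `v`. -/
def Blocked (G : GainedGraph V E Γ) (j : ℕ) (v u : V) (x : Γ) : Prop :=
  (Odd j ∧ x ^ 2 = 1) ∨ GroupBlocked G j v u x ∨ NearBlocked G j v u x

omit [CommGroup Γ] in
theorem fixedVerts_card_le (hf : G.fixed.card ≤ 1) (X : Subgraph G) :
    (X.fixedVerts.card : ℤ) ≤ 1 := by
  have : X.fixedVerts ⊆ G.fixed := Finset.inter_subset_right
  exact_mod_cast (Finset.card_le_card this).trans hf

omit [CommGroup Γ] in
theorem noFixed_iff : NoFixed G X ↔ X.fixedVerts.card = 0 := by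
  rw [Finset.card_eq_zero, Subgraph.fixedVerts, ← Finset.disjoint_iff_inter_eq_empty,
    Finset.disjoint_left]
  rfl

omit [DecidableEq V] [CommGroup Γ] in
theorem Subgraph.le_top [Fintype V] [Fintype E] (X : Subgraph G) : X ≤ ⊤ :=
  ⟨Finset.subset_univ _, Finset.subset_univ _⟩

omit [CommGroup Γ] in
theorem Avoiding.union [DecidableEq E] (hX : Avoiding v u X) (hY : Avoiding v u Y) :
    Avoiding v u (X.union Y) where
  conn := union_connected hX.conn hY.conn hX.base_mem hY.base_mem
  base_mem := Finset.mem_union_left _ hX.base_mem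
  apex_notMem h := (Finset.mem_union.1 h).elim hX.apex_notMem hY.apex_notMem

omit [DecidableEq V] in
theorem exists_first_return_ne_one (hc : Connected G X) (hu : u ∈ X.verts)
    (h : gainGroup G X ≠ ⊥) : ∃ L, IsWalk G X L u u ∧
      (∀ y ∈ (L.map (stepEnd G)).dropLast, y ≠ u) ∧ walkGain G L ≠ 1 := by
  by_contra! hno
  exact h (le_bot_iff.1 (gainGroup_le_of_first_return hc hu fun L hL hLu =>
    Subgroup.mem_bot.2 (hno L hL hLu)))

namespace PendantTriple

variable [DecidableEq E] {k : ℕ} {s : Fin 3 → E × Bool}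
variable (h : PendantTriple G v u s)
include h

theorem gainGroup_union_ne (hX : Avoiding v u X) :
    gainGroup G (X.union (tripleSpan G s)) ≠ ⊥ ∧
      Nat.card (gainGroup G (X.union (tripleSpan G s))) ≠ 2 := by
  have hm := ((h.gainGroup_union_le_iff hX.apex_notMem).1 le_rfl).2
  have h01 := h.loopGain_ne_one (p := 0) (q := 1) (by decide)
  have h12 := h.loopGain_ne_one (p := 1) (q := 2) (by decide)
  have h02 := h.loopGain_ne_one (p := 0) (q := 2) (by decide)
  constructor
  · intro hb
    exact h01 (Subgroup.mem_bot.1 (hb ▸ hm 0 1))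
  · intro h2
    have h3 := sq_eq_one_of_card_eq_two h2 (hm 0 1)
    rw [← loopGain_mul G s 0 1 2, ← eq_of_card_eq_two h2 (hm 0 1) (hm 1 2) h01 h12, ← sq] at h02
    exact h02 h3

variable [IsCyclic Γ] [Finite Γ] (hk : Nat.card Γ = k) (hf : G.fixed.card ≤ 1)
include hk hf

theorem alpha_union_le (hX : Avoiding v u X) :
    alpha G k j (X.union (tripleSpan G s)) ≤ 3 - 2 * (X.fixedVerts.card : ℤ) := by
  have hne := h.gainGroup_union_ne hX
  have := fixedVerts_card_le hf X
  rw [alpha_eq hk, h.fixedVerts_union hX.base_mem, if_neg hne.1, if_neg fun h' => hne.2 h'.2]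
  split_ifs <;> omega

omit hf in
theorem alpha_union_le_of_le_powKer (hX : Avoiding v u X) {i : ℤ} (hi : -1 ≤ i ∧ i ≤ 1)
    (hXi : gainGroup G X ≤ powKer Γ ((j : ℤ) - i))
    (hKi : ∀ p q, loopGain G s p q ∈ powKer Γ ((j : ℤ) - i))
    (hφ : X.fixedVerts.card = 0 ∨ i = 0) :
    alpha G k j (X.union (tripleSpan G s)) ≤ 2 - 2 * (X.fixedVerts.card : ℤ) := by
  have hne := h.gainGroup_union_ne hX
  have hle := (h.gainGroup_union_le_iff hX.apex_notMem).2 ⟨hXi, hKi⟩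
  have hbad : ∀ i' : ℤ, -1 ≤ i' → i' ≤ 1 → i ≠ i' →
      ¬ gainGroup G (X.union (tripleSpan G s)) ≤ powKer Γ ((j : ℤ) - i') := by
    intro i' h1 h2 h3 h4
    rcases eq_bot_or_card_eq_two_of_le_powKer hi.1 hi.2 h1 h2 h3 hle h4 with h5 | h5
    · exact hne.1 h5
    · exact hne.2 h5.2
  rw [alpha_eq hk, h.fixedVerts_union hX.base_mem, if_neg hne.1, if_neg fun h' => hne.2 h'.2]
  by_cases h0 : i = 0
  · subst h0
    rw [if_neg fun h' => h'.elim (hbad (-1) (by omega) (by omega) (by omega))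
      (hbad 1 (by omega) (by omega) (by omega)), if_pos (Or.inl hle)]
  · rw [if_pos]
    · rw [hφ.resolve_right h0]; simp
    · rcases (by omega : i = -1 ∨ i = 1) with rfl | rfl
      · exact Or.inl hle
      · exact Or.inr hle

variable [Fintype V] [Fintype E] (hs : GainSparseKJ G k j (⊤ : Subgraph G))
include hs

omit hk hf [IsCyclic Γ] [Finite Γ] in
theorem excess_add_one_le (hX : Avoiding v u X) :
    excess X + 1 ≤ alpha G k j (X.union (tripleSpan G s)) := by
  rw [← h.excess_union hX.base_mem hX.apex_notMem]
  exact hs.excess_le_alpha (Subgraph.le_top _) (h.union_connected hX.conn hX.base_mem)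
    ⟨_, Finset.mem_union_right _ (mem_tripleSpan_edges 0)⟩

theorem excess_le (hX : Avoiding v u X) : excess X ≤ 2 - 2 * (X.fixedVerts.card : ℤ) := by
  have h1 := h.excess_add_one_le hs hX
  have h2 := h.alpha_union_le (j := j) hk hf hX
  omega

omit hf in
theorem excess_lt_of_le_powKer (hX : Avoiding v u X) {i : ℤ} (hi : -1 ≤ i ∧ i ≤ 1)
    (hXi : gainGroup G X ≤ powKer Γ ((j : ℤ) - i))
    (hKi : ∀ p q, loopGain G s p q ∈ powKer Γ ((j : ℤ) - i))
    (hφ : X.fixedVerts.card = 0 ∨ i = 0) :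
    excess X < 2 - 2 * (X.fixedVerts.card : ℤ) := by
  have h1 := h.excess_add_one_le hs hX
  have h2 := h.alpha_union_le_of_le_powKer hk hX hi hXi hKi hφ
  omega

/-- Two dense subgraphs at `u` share a connected subgraph at `u` that is neither balanced nor,
for odd `j`, of gain group `ℤ₂`. -/
theorem exists_common_subgraph (hX : Avoiding v u X) (hY : Avoiding v u Y)
    (hY0 : Y.fixedVerts.card = 0) (hXe : 2 - 2 * (X.fixedVerts.card : ℤ) ≤ excess X)
    (hYe : 2 ≤ excess Y) : ∃ I : Subgraph G, Connected G I ∧ u ∈ I.verts ∧ I ≤ X ∧ I ≤ Y ∧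
      gainGroup G I ≠ ⊥ ∧ ¬ (Odd j ∧ Nat.card (gainGroup G I) = 2) := by
  have hφ : (X.union Y).fixedVerts = X.fixedVerts := by
    simp only [Subgraph.fixedVerts, Subgraph.union, Finset.union_inter_distrib_right]
    rw [Finset.card_eq_zero, Subgraph.fixedVerts] at hY0
    rw [hY0, Finset.union_empty]
  have h1 := h.excess_le hk hf hs (hX.union hY)
  rw [hφ] at h1
  have h2 := excess_union_add_inter X Y
  have h3 := hs.excess_le_comp (Subgraph.le_top (X.inter Y)) u
  have hu : u ∈ (X.inter Y).verts := Finset.mem_inter.2 ⟨hX.base_mem, hY.base_mem⟩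
  have hc := comp_connected hu
  have h4 := hs.excess_le_alpha (Subgraph.le_top _) hc
    (hc.edges_nonempty_of_one_lt_excess (by omega))
  have hle := comp_le (X.inter Y) u
  exact ⟨_, hc, mem_comp_verts.2 (Reachable.refl hu),
    Subgraph.le_trans hle ⟨Finset.inter_subset_left, Finset.inter_subset_left⟩,
    Subgraph.le_trans hle ⟨Finset.inter_subset_right, Finset.inter_subset_right⟩,
    gainGroup_of_two_le_alpha hk (by omega)⟩

theorem not_groupBlocked_groupBlocked
    (hgen : ∀ S : Subgroup Γ, x ∈ S → y ∈ S → ∀ p q, loopGain G s p q ∈ S)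
    (hx : GroupBlocked G j v u x) (hy : GroupBlocked G j v u y) : False := by
  obtain ⟨X, i, hX, hi, hxi, hXi, hφX, heX⟩ := hx
  obtain ⟨Y, i', hY, hi', hyi, hYi, hφY, heY⟩ := hy
  by_cases hii : i = i'
  · subst hii
    exact absurd heX (not_le.2 (h.excess_lt_of_le_powKer hk hs hX hi hXi (hgen _ hxi hyi) hφX))
  obtain ⟨I, -, -, hIX, hIY, hI1, hI2⟩ : ∃ I : Subgraph G, Connected G I ∧ u ∈ I.verts ∧
      I ≤ X ∧ I ≤ Y ∧ gainGroup G I ≠ ⊥ ∧ ¬ (Odd j ∧ Nat.card (gainGroup G I) = 2) := by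
    rcases (by omega : Y.fixedVerts.card = 0 ∨ X.fixedVerts.card = 0) with h0 | h0
    · exact h.exists_common_subgraph hk hf hs hX hY h0 heX (by simpa [h0] using heY)
    · obtain ⟨I, h1, h2, h3, h4, h5⟩ := h.exists_common_subgraph hk hf hs hY hX h0 heY
        (by simpa [h0] using heX)
      exact ⟨I, h1, h2, h4, h3, h5⟩
  rcases eq_bot_or_card_eq_two_of_le_powKer hi.1 hi.2 hi'.1 hi'.2 hii
    ((gainGroup_mono hIX).trans hXi) ((gainGroup_mono hIY).trans hYi) with h1 | h1
  · exact hI1 h1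
  · exact hI2 h1

theorem not_groupBlocked_nearBlocked
    (hgen : ∀ S : Subgroup Γ, x ∈ S → y ∈ S → ∀ p q, loopGain G s p q ∈ S)
    (hx : GroupBlocked G j v u x) (hy : NearBlocked G j v u y) : False := by
  obtain ⟨X, i, hX, hi, hxi, hXi, hφX, heX⟩ := hx
  obtain ⟨Y, hY, hφY, heY, hnb, -⟩ := hy
  obtain ⟨I, hIc, hIu, hIX, hIY, hI1, -⟩ := h.exists_common_subgraph hk hf hs hX hY hφY heX heY
  obtain ⟨L, hL, hLu, hL1⟩ := exists_first_return_ne_one hIc hIu hI1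
  have hLX : walkGain G L ∈ powKer Γ ((j : ℤ) - i) := by
    refine hXi (gainGroup_mono hIX (walkGain_mem_gainGroup (fun z hz hzf => ?_) hL))
    exact noFixed_iff.2 hφY z (hIY.1 hz) hzf
  have hyi : y ∈ powKer Γ ((j : ℤ) - i) := by
    rcases hnb L (hL.mono hIY) hLu with h1 | h1 | h1
    · exact absurd h1 hL1
    · exact h1 ▸ hLX
    · rw [h1] at hLX
      simpa using Subgroup.inv_mem _ hLX
  exact absurd heX (not_le.2 (h.excess_lt_of_le_powKer hk hs hX hi hXi (hgen _ hxi hyi) hφX))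

theorem eq_or_mul_eq_one_of_nearBlocked (hx : NearBlocked G j v u x)
    (hy : NearBlocked G j v u y) : x = y ∨ x * y = 1 := by
  obtain ⟨X, hX, hφX, heX, hnbX, -⟩ := hx
  obtain ⟨Y, hY, hφY, heY, hnbY, -⟩ := hy
  obtain ⟨I, hIc, hIu, hIX, hIY, hI1, -⟩ := h.exists_common_subgraph hk hf hs hX hY hφY
    (by simpa [hφX] using heX) heY
  obtain ⟨L, hL, hLu, hL1⟩ := exists_first_return_ne_one hIc hIu hI1
  rcases hnbX L (hL.mono hIX) hLu with h1 | h1 | h1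
  · exact absurd h1 hL1
  all_goals rcases hnbY L (hL.mono hIY) hLu with h2 | h2 | h2
  · exact absurd h2 hL1
  · exact Or.inl (h1.symm.trans h2)
  · exact Or.inr (mul_eq_one_iff_eq_inv.2 (h1.symm.trans h2))
  · exact absurd h2 hL1
  · exact Or.inr (mul_eq_one_iff_inv_eq.2 (h1.symm.trans h2))
  · exact Or.inl (inv_injective (h1.symm.trans h2))

theorem nearBlocked_and_eq {p q r : Fin 3} (hpq : p ≠ q) (hqr : q ≠ r) (hpr : p ≠ r)
    (hx : GroupBlocked G j v u (loopGain G s p q) ∨ NearBlocked G j v u (loopGain G s p q))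
    (hy : GroupBlocked G j v u (loopGain G s q r) ∨ NearBlocked G j v u (loopGain G s q r)) :
    NearBlocked G j v u (loopGain G s p q) ∧ loopGain G s p q = loopGain G s q r := by
  have hgen : ∀ S : Subgroup Γ, loopGain G s p q ∈ S → loopGain G s q r ∈ S →
      ∀ a b, loopGain G s a b ∈ S := fun S h1 h2 => loopGain_mem_of_adjacent hpq hqr hpr h1 h2
  rcases hx with hx | hx <;> rcases hy with hy | hy
  · exact (h.not_groupBlocked_groupBlocked hk hf hs hgen hx hy).elim
  · exact (h.not_groupBlocked_nearBlocked hk hf hs hgen hx hy).elim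
  · exact (h.not_groupBlocked_nearBlocked hk hf hs (fun S h1 h2 => hgen S h2 h1) hy hx).elim
  · refine ⟨hx, (h.eq_or_mul_eq_one_of_nearBlocked hk hf hs hx hy).resolve_right fun h1 => ?_⟩
    rw [loopGain_mul] at h1
    exact h.loopGain_ne_one hpr h1

/-- Some loop arising from a 1-reduction at `v` has no obstruction. -/
theorem exists_not_blocked : ∃ p q, p ≠ q ∧ ¬ Blocked G j v u (loopGain G s p q) := by
  by_contra! hall
  have two : ∀ p q r : Fin 3, p ≠ q → q ≠ r → p ≠ r → loopGain G s p q ^ 2 = 1 →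
      loopGain G s q r ^ 2 = 1 → False := by
    intro p q r hpq hqr hpr h1 h2
    have h3 := eq_of_sq_eq_one h1 h2 (h.loopGain_ne_one hpq) (h.loopGain_ne_one hqr)
    rw [sq] at h1
    nth_rewrite 2 [h3] at h1
    rw [loopGain_mul] at h1
    exact h.loopGain_ne_one hpr h1
  have one : ∀ p q r : Fin 3, p ≠ q → q ≠ r → p ≠ r → Odd j → loopGain G s p q ^ 2 = 1 →
      False := by
    intro p q r hpq hqr hpr hj h1
    have hx := (hall q r hqr).resolve_left fun h2 => two p q r hpq hqr hpr h1 h2.2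
    have hy := (hall r p hpr.symm).resolve_left fun h2 =>
      two r p q hpr.symm hpq hqr.symm h2.2 h1
    obtain ⟨⟨-, -, -, -, -, hno⟩, heq⟩ :=
      h.nearBlocked_and_eq hk hf hs hqr hpr.symm hpq.symm hx hy
    have h3 : loopGain G s q r ^ 4 = 1 := by
      have h4 : loopGain G s q r ^ 2 = loopGain G s q p := by
        rw [sq, ← loopGain_mul G s q r p, ← heq]
      rw [pow_mul (loopGain G s q r) 2 2, h4, ← loopGain_inv, inv_pow, h1, inv_one]
    obtain ⟨i, hi, hi1, hmem⟩ := mem_powKer_of_pow_four h3 hj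
    exact hno i hi hi1 hmem
  have hx := (hall 0 1 (by decide)).resolve_left fun h1 =>
    one 0 1 2 (by decide) (by decide) (by decide) h1.1 h1.2
  have hy := (hall 1 2 (by decide)).resolve_left fun h1 =>
    one 1 2 0 (by decide) (by decide) (by decide) h1.1 h1.2
  have hz := (hall 2 0 (by decide)).resolve_left fun h1 =>
    one 2 0 1 (by decide) (by decide) (by decide) h1.1 h1.2
  obtain ⟨⟨-, -, -, -, -, hno⟩, h01⟩ :=
    h.nearBlocked_and_eq hk hf hs (by decide) (by decide) (by decide) hx hy
  obtain ⟨-, h12⟩ := h.nearBlocked_and_eq hk hf hs (by decide) (by decide) (by decide) hy hz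
  have h3 : loopGain G s 0 1 ^ 3 = 1 := by
    have h4 := loopGain_mul G s 0 1 2
    have h5 := loopGain_mul G s 0 2 0
    rw [← h4, ← h12, ← h01, loopGain_self] at h5
    rw [pow_succ, sq, h5]
  obtain ⟨i, hi, hi1, hmem⟩ := mem_powKer_of_pow_three h3 j
  exact hno i hi hi1 hmem

end PendantTriple

end Blocked

section Extend

variable {V E Γ : Type} {G : GainedGraph V E Γ} {u : V} {g : Γ}

/-- The part of a subgraph of the extended graph that lies in the original graph. -/
def restrict (X : Subgraph (extendGraph G u u g)) : Subgraph G where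
  verts := X.verts
  edges := X.edges.eraseNone
  tail_mem e he := X.tail_mem (some e) (Finset.mem_eraseNone.1 he)
  head_mem e he := X.head_mem (some e) (Finset.mem_eraseNone.1 he)

/-- A traversal of an edge, viewed in the extended graph. -/
def someStep (s : E × Bool) : Option E × Bool := (some s.1, s.2)

variable {X : Subgraph (extendGraph G u u g)}

theorem IsWalk.map_someStep {L : List (E × Bool)} {x y : V} (hL : IsWalk G (restrict X) L x y) :
    IsWalk (extendGraph G u u g) X (L.map someStep) x y := by
  induction L generalizing x with
  | nil => exact hL
  | cons s L ih => exact ⟨Finset.mem_eraseNone.1 hL.1, hL.2.1, ih hL.2.2⟩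

theorem IsWalk.exists_map_someStep (hX : none ∉ X.edges) {L : List (Option E × Bool)} {x y : V}
    (hL : IsWalk (extendGraph G u u g) X L x y) :
    ∃ M, L = M.map someStep ∧ IsWalk G (restrict X) M x y := by
  induction L generalizing x with
  | nil => exact ⟨[], rfl, hL⟩
  | cons s L ih =>
    rcases s with ⟨_ | e, b⟩
    · exact absurd hL.1 hX
    · obtain ⟨M, rfl, hM⟩ := ih hL.2.2
      exact ⟨(e, b) :: M, rfl, Finset.mem_eraseNone.2 hL.1, hL.2.1, hM⟩

theorem map_stepEnd_someStep (L : List (E × Bool)) :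
    (L.map someStep).map (stepEnd (extendGraph G u u g)) = L.map (stepEnd G) := by
  rw [List.map_map]
  rfl

theorem reachable_extend_iff {x y : V} :
    Reachable (extendGraph G u u g) X x y ↔ Reachable G (restrict X) x y := by
  constructor
  · rintro ⟨L, hL⟩
    induction L generalizing x with
    | nil => exact ⟨[], hL⟩
    | cons s L ih =>
      refine Reachable.trans ?_ (ih hL.2.2)
      rcases s with ⟨_ | e, b⟩
      · have h1 : u = x := by
          have := hL.2.1
          cases b <;> exact this
        have h2 : stepEnd (extendGraph G u u g) (none, b) = x := by
          cases b <;> exact h1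
        rw [h2]
        exact Reachable.refl hL.left_mem
      · have := isWalk_singleton (G := G) (H := restrict X) (s := (e, b))
          (Finset.mem_eraseNone.2 hL.1)
        rw [← hL.2.1]
        exact ⟨_, this⟩
  · rintro ⟨L, hL⟩
    exact ⟨_, hL.map_someStep⟩

theorem connected_extend_iff :
    Connected (extendGraph G u u g) X ↔ Connected G (restrict X) := by
  simp only [Connected, reachable_extend_iff]
  rfl

end Extend

section ExtendGain

variable {V E Γ : Type} [CommGroup Γ] {G : GainedGraph V E Γ} {u : V} {g : Γ}
  {X : Subgraph (extendGraph G u u g)}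

theorem walkGain_map_someStep (L : List (E × Bool)) :
    walkGain (extendGraph G u u g) (L.map someStep) = walkGain G L := by
  rw [walkGain, List.map_map]
  rfl

theorem gainGroup_extend_le_iff (hu : u ∉ G.fixed) {S : Subgroup Γ} :
    gainGroup (extendGraph G u u g) X ≤ S ↔
      gainGroup G (restrict X) ≤ S ∧ (none ∈ X.edges → g ∈ S) := by
  simp only [gainGroup_le_iff]
  constructor
  · rintro ⟨φ, hφ⟩
    refine ⟨⟨φ, fun e he => hφ (some e) (Finset.mem_eraseNone.1 he)⟩, fun hn => ?_⟩
    have : φ u * g * (φ u)⁻¹ ∈ S := hφ none hn hu hu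
    simpa [mul_comm] using this
  · rintro ⟨⟨φ, hφ⟩, hg⟩
    refine ⟨φ, ?_⟩
    rintro (_ | e) he ht hh
    · have : φ u * g * (φ u)⁻¹ ∈ S := by simpa [mul_comm] using hg he
      exact this
    · exact hφ e (Finset.mem_eraseNone.2 he) ht hh

theorem gain_mem_gainGroup_extend (hu : u ∉ G.fixed) (hX : none ∈ X.edges) :
    g ∈ gainGroup (extendGraph G u u g) X :=
  ((gainGroup_extend_le_iff hu).1 le_rfl).2 hX

theorem gainGroup_extend (hu : u ∉ G.fixed) (hX : none ∉ X.edges) :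
    gainGroup (extendGraph G u u g) X = gainGroup G (restrict X) :=
  le_antisymm ((gainGroup_extend_le_iff hu).2 ⟨le_rfl, fun h => absurd h hX⟩)
    ((gainGroup_extend_le_iff hu).1 le_rfl).1

variable [DecidableEq V]

omit [CommGroup Γ] in
theorem fixedVerts_restrict : (restrict X).fixedVerts = X.fixedVerts := rfl

theorem alpha_extend [IsCyclic Γ] [Finite Γ] {k j : ℕ} (hk : Nat.card Γ = k) (hu : u ∉ G.fixed)
    (hX : none ∉ X.edges) : alpha (extendGraph G u u g) k j X = alpha G k j (restrict X) := by
  have hA := gainGroup_extend hu hX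
  have hP : ProperNearBalanced (extendGraph G u u g) X ↔ ProperNearBalanced G (restrict X) := by
    have hN : ∀ w δ, NearBalancedAt (extendGraph G u u g) X w δ ↔
        NearBalancedAt G (restrict X) w δ := by
      intro w δ
      simp only [NearBalancedAt, Balanced, hA]
      refine and_congr_right fun _ => ⟨fun h L hL hLw => ?_, fun h L hL hLw => ?_⟩
      · rw [← walkGain_map_someStep (u := u) (g := g)]
        exact h _ hL.map_someStep (by rwa [map_stepEnd_someStep])
      · obtain ⟨M, rfl, hM⟩ := hL.exists_map_someStep hX
        rw [walkGain_map_someStep]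
        rw [map_stepEnd_someStep] at hLw
        exact h _ hM hLw
    simp only [ProperNearBalanced, NearBalanced, isZIso_iff, hA, hN]
    rfl
  rw [alpha_eq hk, alpha_eq hk, hA, fixedVerts_restrict, hP]

variable [DecidableEq E]

omit [CommGroup Γ] in
theorem restrict_edgeSpan (F : Finset E) :
    restrict (edgeSpan (extendGraph G u u g) (F.map Function.Embedding.some)) = edgeSpan G F := by
  refine Subgraph.ext_of_eq ?_ ?_
  · simp only [restrict, edgeSpan, Finset.map_eq_image, Finset.image_image]
    rfl
  · simp [restrict, edgeSpan]

omit [CommGroup Γ] in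
theorem edgeSpan_map_verts (F : Finset E) :
    (edgeSpan (extendGraph G u u g) (F.map Function.Embedding.some)).verts =
      (edgeSpan G F).verts :=
  congrArg Subgraph.verts (restrict_edgeSpan F)

theorem fCount_extend [IsCyclic Γ] [Finite Γ] {k j : ℕ} (hk : Nat.card Γ = k) (hu : u ∉ G.fixed)
    (F : Finset E) :
    fCount (extendGraph G u u g) k j (F.map Function.Embedding.some) = fCount G k j F := by
  induction F using component_induction (G := G) with
  | h0 => simp [fCount_empty]
  | hstep A B hA hc hd ih =>
    rw [Finset.map_union, fCount_union, fCount_union hd, ih, fCount_of_connected hA hc,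
      fCount_of_connected (hA.map), connBound, connBound, edgeSpan_map_verts,
      alpha_extend hk hu, restrict_edgeSpan]
    · simp [edgeSpan]
    · rwa [connected_extend_iff, restrict_edgeSpan]
    · rwa [edgeSpan_map_verts, edgeSpan_map_verts]

end ExtendGain

section Admissible

variable {V E Γ : Type} [DecidableEq V] [CommGroup Γ]
  [IsCyclic Γ] [Finite Γ] {G : GainedGraph V E Γ} {k j : ℕ} {v u : V} {g : Γ}

omit [IsCyclic Γ] [Finite Γ] in
/-- A loop at `u` of gain `g` or `g⁻¹` obstructs a further loop of gain `g`. -/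
theorem blocked_of_loop (huv : u ≠ v) (hu : u ∉ G.fixed) {e : E} (ht : G.tail e = u)
    (hh : G.head e = u) (hg : G.gain e = g ∨ G.gain e = g⁻¹) : Blocked G j v u g := by
  set X : Subgraph G := ⟨{u}, {e}, by simp [ht], by simp [hh]⟩ with hX
  have hA : Avoiding v u X :=
    ⟨connected_of_forall_reachable (u := u) (by simp [hX]) fun x hx => by
      rw [Finset.mem_singleton.1 hx]; exact Reachable.refl (by simp [hX]),
      by simp [hX], by simpa [hX] using huv.symm⟩
  have hφ : X.fixedVerts.card = 0 := by
    rw [← noFixed_iff]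
    intro x hx
    rwa [Finset.mem_singleton.1 hx]
  have hex : excess X = 2 := by simp [excess, hX]
  by_cases hi : ∃ i : ℤ, (-1 ≤ i ∧ i ≤ 1) ∧ g ∈ powKer Γ ((j : ℤ) - i)
  · obtain ⟨i, hi, hgi⟩ := hi
    refine Or.inr (Or.inl ⟨X, i, hA, hi, hgi, ?_, Or.inl hφ, by simp [hφ, hex]⟩)
    refine gainGroup_le_iff.2 ⟨1, fun e' he' _ _ => ?_⟩
    rw [Finset.mem_singleton.1 he']
    rcases hg with hg | hg <;> simpa [hg] using hgi
  · push Not at hi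
    refine Or.inr (Or.inr ⟨X, hA, hφ, hex.ge, fun L hL hLu => ?_, fun i h1 h2 => hi i ⟨h1, h2⟩⟩)
    rcases L with _ | ⟨⟨e', b⟩, _ | ⟨s', L⟩⟩
    · simp
    · have he' : e' = e := Finset.mem_singleton.1 hL.1
      subst he'
      rcases hg with hg | hg <;> cases b <;> simp [stepGain, hg]
    · exact absurd (Finset.mem_singleton.1 hL.2.2.left_mem) (hLu _ (by simp))

omit [DecidableEq V] [Finite Γ] in
/-- If adding the loop of gain `g` at `u` makes `X` proper near-balanced, then `X` is near-balanced
at `u` with gain `g`. -/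
theorem ProperNearBalanced.restrict_walkGain_mem {X : Subgraph (extendGraph G u u g)}
    (hP : ProperNearBalanced (extendGraph G u u g) X)
    (hc : Connected (extendGraph G u u g) X) (hu : u ∉ G.fixed) (hX : none ∈ X.edges)
    (hg1 : g ≠ 1) :
    gainGroup (extendGraph G u u g) X = Subgroup.zpowers g ∧
      ∀ L, IsWalk G (restrict X) L u u → (∀ y ∈ (L.map (stepEnd G)).dropLast, y ≠ u) →
        walkGain G L ∈ ({1, g, g⁻¹} : Set Γ) := by
  obtain ⟨⟨hfree, w, hw, δ, -, hnb⟩, h2, h3⟩ := hP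
  have huX : u ∈ X.verts := X.tail_mem none hX
  have hloop : IsWalk (extendGraph G u u g) X [(none, true)] u u := ⟨hX, rfl, rfl, huX⟩
  have hgδ : g ∈ ({1, δ, δ⁻¹} : Set Γ) := by
    by_cases hwu : u = w
    · subst hwu
      simpa [stepGain, extendGraph] using hnb _ hloop (by simp)
    · obtain ⟨L, hL, hLw, hLg⟩ := exists_first_return_conj (hc.2 w hw u huX) hwu hloop
        (by simpa [stepEnd, extendGraph] using hwu)
      have := hnb L hL hLw
      rw [hLg] at this
      simpa [stepGain, extendGraph] using this
  have hset : ({1, δ, δ⁻¹} : Set Γ) = {1, g, g⁻¹} := by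
    rcases hgδ with h | h | h
    · exact absurd h hg1
    · rw [h]
    · rw [Set.mem_singleton_iff.1 h, inv_inv, Set.pair_comm δ]
  rw [hset] at hnb
  have hA : gainGroup (extendGraph G u u g) X = Subgroup.zpowers g := by
    apply le_antisymm
    · refine gainGroup_le_of_first_return hc hw fun L hL hLw => ?_
      rcases hnb L hL hLw with hL | hL | hL <;> rw [hL]
      · exact Subgroup.one_mem _
      · exact Subgroup.mem_zpowers g
      · exact Subgroup.inv_mem _ (Subgroup.mem_zpowers g)
    · exact Subgroup.zpowers_le.2 (gain_mem_gainGroup_extend hu hX)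
  refine ⟨hA, ?_⟩
  by_cases hwu : u = w
  · subst hwu
    intro L hL hLu
    rw [← walkGain_map_someStep (u := u) (g := g)]
    exact hnb _ hL.map_someStep (by rwa [map_stepEnd_someStep])
  · exfalso
    have hloop2 : IsWalk (extendGraph G u u g) X [(none, true), (none, true)] u u :=
      ⟨hX, rfl, hloop⟩
    obtain ⟨L, hL, hLw, hLg⟩ := exists_first_return_conj (hc.2 w hw u huX) hwu hloop2
      (by simpa [stepEnd, extendGraph] using hwu)
    have h4 := hnb L hL hLw
    have h5 : walkGain (extendGraph G u u g) L = g ^ 2 := by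
      rw [hLg, sq]
      simp [stepGain, extendGraph]
    rw [isZIso_iff, hA, Nat.card_zpowers] at h2 h3
    rw [h5] at h4
    rcases h4 with h4 | h4 | h4
    · exact h2 (orderOf_eq_prime h4 hg1)
    · rw [sq] at h4
      exact hg1 (by simpa using h4)
    · refine h3 (orderOf_eq_prime ?_ hg1)
      rw [pow_succ, Set.mem_singleton_iff.1 h4, inv_mul_cancel]

namespace PendantTriple

variable [DecidableEq E] [Fintype V] [Fintype E] {s : Fin 3 → E × Bool}
variable (h : PendantTriple G v u s) (hk : Nat.card Γ = k) (hf : G.fixed.card ≤ 1)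
include h hk hf

theorem excess_add_one_le_alpha_extend (hs : GainSparseKJ G k j (⊤ : Subgraph G))
    {X : Subgraph (extendGraph G u u g)} (hc : Connected (extendGraph G u u g) X)
    (hX : none ∈ X.edges) (hvX : v ∉ X.verts) (hg1 : g ≠ 1) (hb : ¬ Blocked G j v u g) :
    excess (restrict X) + 1 ≤ alpha (extendGraph G u u g) k j X := by
  have hu := h.base_free
  have hA : Avoiding v u (restrict X) := ⟨connected_extend_iff.1 hc, X.tail_mem none hX, hvX⟩
  have hg := gain_mem_gainGroup_extend hu hX
  have hle : ∀ {S}, gainGroup (extendGraph G u u g) X ≤ S → gainGroup G (restrict X) ≤ S :=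
    fun h' => ((gainGroup_extend_le_iff hu).1 h').1
  have hub := h.excess_le hk hf hs hA
  have hφ := fixedVerts_card_le hf (restrict X)
  rw [fixedVerts_restrict] at hub hφ
  by_contra hlt
  rw [alpha_eq hk] at hlt
  split_ifs at hlt with h1 h2 h3 h4
  · exact hg1 (Subgroup.mem_bot.1 (h1 ▸ hg))
  · exact hb (Or.inl ⟨h2.1, sq_eq_one_of_card_eq_two h2.2 hg⟩)
  · have hφ0 : X.fixedVerts.card = 0 := by omega
    rcases h3 with h3 | h3
    · exact hb (Or.inr (Or.inl ⟨_, -1, hA, by omega, h3 hg, hle h3, Or.inl hφ0, by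
        rw [fixedVerts_restrict]; omega⟩))
    · exact hb (Or.inr (Or.inl ⟨_, 1, hA, by omega, h3 hg, hle h3, Or.inl hφ0, by
        rw [fixedVerts_restrict]; omega⟩))
  · by_cases h5 : gainGroup (extendGraph G u u g) X ≤ powKer Γ ((j : ℤ) - 0)
    · exact hb (Or.inr (Or.inl ⟨_, 0, hA, by omega, h5 hg, hle h5, Or.inr rfl, by
        rw [fixedVerts_restrict]; omega⟩))
    · obtain ⟨hφ0, hP⟩ := h4.resolve_left h5
      obtain ⟨hz, hw⟩ := hP.restrict_walkGain_mem hc hu hX hg1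
      rw [hz, Subgroup.zpowers_le] at h5
      rw [hz, Subgroup.zpowers_le, Subgroup.zpowers_le, not_or] at h3
      refine hb (Or.inr (Or.inr ⟨_, hA, hφ0, by omega, hw, fun i hi hi1 => ?_⟩))
      rcases (by omega : i = -1 ∨ i = 0 ∨ i = 1) with rfl | rfl | rfl
      · exact h3.1
      · exact h5
      · exact h3.2
  · omega

theorem sparse_reduceAt (hs : GainSparseKJ G k j (⊤ : Subgraph G)) (hg1 : g ≠ 1)
    (hb : ¬ Blocked G j v u g) : GainSparseKJ (extendGraph G u u g) k j
      (reduceAt (extendGraph G u u g) (extendTop G u u g) v none) := by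
  rw [gainSparseKJ_iff]
  intro X hX hc hne
  have hvX : v ∉ X.verts := by
    intro hv
    have := hX.1 hv
    simp [reduceAt, extendGraph, h.ne.symm] at this
  by_cases hn : none ∈ X.edges
  · have h1 := h.excess_add_one_le_alpha_extend hk hf hs hc hn hvX hg1 hb
    have h2 := Finset.card_eraseNone_of_mem hn
    have h3 := Finset.card_pos.2 hne
    simp only [excess, restrict, h2] at h1
    unfold connBound
    omega
  · have h2 := Finset.card_eraseNone_of_not_mem hn
    have h1 := gainSparseKJ_iff.1 hs (restrict X) (Subgraph.le_top _) (connected_extend_iff.1 hc)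
      (Finset.card_pos.1 (by
        change 0 < (X.edges.eraseNone).card
        rw [h2]; exact Finset.card_pos.2 hne))
    rw [connBound, alpha_extend hk h.base_free hn]
    rw [connBound] at h1
    simp only [restrict, h2] at h1 ⊢
    exact h1

omit [Fintype V] [Fintype E] in
theorem alpha_extend_le_alpha_union {Y : Subgraph G} (hY : Avoiding v u Y)
    {X : Subgraph (extendGraph G u u g)} (hXY : restrict X = Y) (hX : none ∈ X.edges)
    (hg1 : g ≠ 1) (hg : ∃ p q, g = loopGain G s p q) :
    alpha (extendGraph G u u g) k j X ≤ alpha G k j (Y.union (tripleSpan G s)) := by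
  have hne := h.gainGroup_union_ne hY
  have hnp := h.not_properNearBalanced (h.union_connected hY.conn hY.base_mem)
    ⟨Finset.subset_union_right, Finset.subset_union_right⟩
  have hgX := gain_mem_gainGroup_extend h.base_free hX
  have hle : gainGroup (extendGraph G u u g) X ≤ gainGroup G (Y.union (tripleSpan G s)) := by
    have h1 := (h.gainGroup_union_le_iff hY.apex_notMem).1 le_rfl
    obtain ⟨p, q, rfl⟩ := hg
    exact (gainGroup_extend_le_iff h.base_free).2 ⟨hXY ▸ h1.1, fun _ => h1.2 p q⟩
  have hφ := fixedVerts_card_le hf Y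
  have hφX : X.fixedVerts = Y.fixedVerts := hXY ▸ rfl
  have hbot : gainGroup (extendGraph G u u g) X ≠ ⊥ := fun hb =>
    hg1 (Subgroup.mem_bot.1 (hb ▸ hgX))
  rw [alpha_eq hk (G := G), h.fixedVerts_union hY.base_mem, if_neg hne.1,
    if_neg fun h' => hne.2 h'.2]
  rw [alpha_eq hk, if_neg hbot, hφX]
  by_cases hpm : gainGroup G (Y.union (tripleSpan G s)) ≤ powKer Γ ((j : ℤ) - (-1)) ∨
      gainGroup G (Y.union (tripleSpan G s)) ≤ powKer Γ ((j : ℤ) - 1)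
  · rw [if_pos hpm, if_pos (hpm.imp hle.trans hle.trans)]
    split_ifs <;> omega
  rw [if_neg hpm]
  by_cases h0 : gainGroup G (Y.union (tripleSpan G s)) ≤ powKer Γ ((j : ℤ) - 0)
  · have h0' := hle.trans h0
    have hcard : ¬ (Odd j ∧ Nat.card (gainGroup (extendGraph G u u g) X) = 2) := by
      rintro ⟨⟨m, hm⟩, h2⟩
      have h3 : g ∈ powKer Γ 2 := by
        rw [mem_powKer]
        exact_mod_cast sq_eq_one_of_card_eq_two h2 hgX
      exact hg1 (by
        simpa using zpow_eq_one_of_mem_powKer (c := 1) (h0' hgX) h3 1 (-m) (by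
          subst hm; push_cast; ring))
    have hpm' : ∀ i : ℤ, -1 ≤ i → i ≤ 1 → i ≠ 0 →
        ¬ gainGroup (extendGraph G u u g) X ≤ powKer Γ ((j : ℤ) - i) := by
      intro i h1 h2 h3 h4
      rcases eq_bot_or_card_eq_two_of_le_powKer h1 h2 (by norm_num) (by norm_num) h3 h4 h0'
        with h5 | h5
      · exact hbot h5
      · exact hcard h5
    rw [if_neg hcard, if_neg fun h' => h'.elim (hpm' (-1) (by norm_num) (by norm_num) (by norm_num))
      (hpm' 1 (by norm_num) (by norm_num) (by norm_num)), if_pos (Or.inl h0'), if_pos (Or.inl h0)]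
  · have hno : ¬ (gainGroup G (Y.union (tripleSpan G s)) ≤ powKer Γ ((j : ℤ) - 0) ∨
        (Y.fixedVerts.card = 0 ∧ ProperNearBalanced G (Y.union (tripleSpan G s)))) :=
      fun h' => h'.elim h0 fun h'' => hnp h''.2
    rw [if_neg hno]
    split_ifs <;> omega

omit hk hf [IsCyclic Γ] [Finite Γ] [Fintype V] [Fintype E] in
theorem mem_tripleSpan_iff {e : E} :
    e ∈ (tripleSpan G s).edges ↔ G.tail e = v ∨ G.head e = v := by
  constructor
  · intro he
    obtain ⟨i, -, rfl⟩ := Finset.mem_image.1 he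
    rcases h.tail_head i with ⟨-, h2⟩ | ⟨h1, -⟩
    · exact Or.inr h2
    · exact Or.inl h1
  · intro he
    obtain ⟨i, rfl⟩ := h.incident e he
    exact mem_tripleSpan_edges i

omit h hk hf [IsCyclic Γ] [Finite Γ] in
theorem card_eq_fCount_sdiff {C : Subgraph G} (ht : GainTightKJ G k j (⊤ : Subgraph G))
    (hc : Connected G C) (hne : C.edges.Nonempty)
    (hd : Disjoint C.verts (edgeSpan G (Finset.univ \ C.edges)).verts) :
    (C.edges.card : ℤ) = connBound G k j C ∧
      ((Finset.univ \ C.edges).card : ℤ) = fCount G k j (Finset.univ \ C.edges) := by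
  have hC := hc.eq_edgeSpan hne
  have h1 := gainSparseKJ_iff.1 ht.1 C (Subgraph.le_top _) hc hne
  have h2 : ((Finset.univ \ C.edges).card : ℤ) ≤ fCount G k j (Finset.univ \ C.edges) := by
    rcases (Finset.univ \ C.edges).eq_empty_or_nonempty with h0 | h0
    · simp [h0, fCount_empty]
    · exact ht.1 (edgeSpan G _) (Subgraph.le_top _) h0
  have h3 : (Finset.univ : Finset E) = C.edges ∪ (Finset.univ \ C.edges) := by simp
  have h4 : (Finset.univ.card : ℤ) = fCount G k j (Finset.univ : Finset E) := ht.2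
  rw [h3, fCount_union (by rwa [← hC]), fCount_of_connected hne (hC ▸ hc), ← hC,
    Finset.card_union_of_disjoint Finset.disjoint_sdiff] at h4
  push_cast at h4
  omega

theorem tight_reduceAt (ht : GainTightKJ G k j (⊤ : Subgraph G)) (hg1 : g ≠ 1)
    (hb : ¬ Blocked G j v u g) (hg : ∃ p q, g = loopGain G s p q) :
    GainTightKJ (extendGraph G u u g) k j
      (reduceAt (extendGraph G u u g) (extendTop G u u g) v none) := by
  have hsp := h.sparse_reduceAt hk hf ht.1 hg1 hb
  refine ⟨hsp, le_antisymm (hsp _ (Subgraph.le_refl _) ⟨none, Finset.mem_insert_self _ _⟩) ?_⟩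
  set Y := comp ((⊤ : Subgraph G).deleteVertex v) u with hYdef
  have huD : u ∈ ((⊤ : Subgraph G).deleteVertex v).verts :=
    Finset.mem_erase.2 ⟨h.ne, Finset.mem_univ _⟩
  have hY : Avoiding v u Y := ⟨comp_connected huD, mem_comp_verts.2 (Reachable.refl huD), fun hv =>
    Finset.notMem_erase v _ ((comp_le _ _).1 hv)⟩
  set R := Finset.univ \ (Y.union (tripleSpan G s)).edges with hR
  have hCne : (Y.union (tripleSpan G s)).edges.Nonempty :=
    ⟨_, Finset.mem_union_right _ (mem_tripleSpan_edges 0)⟩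
  have hRD : ∀ e ∈ R, (G.tail e ≠ v ∧ G.head e ≠ v) ∧ G.tail e ∉ Y.verts ∧ G.head e ∉ Y.verts := by
    intro e he
    have h1 : e ∉ Y.edges ∧ ¬ (G.tail e = v ∨ G.head e = v) := by
      rw [← h.mem_tripleSpan_iff]
      simpa [hR, Subgraph.union] using he
    have h2 : e ∈ ((⊤ : Subgraph G).deleteVertex v).edges :=
      Finset.mem_filter.2 ⟨Finset.mem_univ _, not_or.1 h1.2⟩
    exact ⟨not_or.1 h1.2, tail_notMem_comp h2 h1.1, head_notMem_comp h2 h1.1⟩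
  have hdC : Disjoint (Y.union (tripleSpan G s)).verts (edgeSpan G R).verts := by
    rw [h.union_verts hY.base_mem, Finset.disjoint_right]
    intro x hx
    simp only [edgeSpan, Finset.mem_union, Finset.mem_image] at hx
    rcases hx with ⟨e, he, rfl⟩ | ⟨e, he, rfl⟩ <;> have h1 := hRD e he <;> simp [h1]
  obtain ⟨hCc, hRc⟩ := card_eq_fCount_sdiff ht (h.union_connected hY.conn hY.base_mem) hCne hdC
  set X : Subgraph (extendGraph G u u g) :=
    { verts := Y.verts
      edges := Y.edges.insertNone
      tail_mem := by
        rintro (_ | e) he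
        · exact hY.base_mem
        · exact Y.tail_mem e (Finset.some_mem_insertNone.1 he)
      head_mem := by
        rintro (_ | e) he
        · exact hY.base_mem
        · exact Y.head_mem e (Finset.some_mem_insertNone.1 he) } with hXdef
  have hXn : none ∈ X.edges := Finset.none_mem_insertNone
  have hXY : restrict X = Y := Subgraph.ext_of_eq rfl (Finset.eraseNone_insertNone _)
  have hXc : Connected (extendGraph G u u g) X := connected_extend_iff.2 (hXY ▸ hY.conn)
  have hXs := hXc.eq_edgeSpan ⟨none, hXn⟩
  have hEdges : (reduceAt (extendGraph G u u g) (extendTop G u u g) v none).edges =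
      X.edges ∪ R.map Function.Embedding.some := by
    ext e
    cases e with
    | none => simp [reduceAt, hXn]
    | some e =>
      have h1 : e ∈ Y.edges → G.tail e ≠ v ∧ G.head e ≠ v := fun he =>
        (Finset.mem_filter.1 ((comp_le _ _).2 he)).2
      have h2 : e ∈ R ↔ e ∉ Y.edges ∧ ¬ (G.tail e = v ∨ G.head e = v) := by
        rw [← h.mem_tripleSpan_iff]
        simp [hR, Subgraph.union]
      have h3 : some e ∈ (reduceAt (extendGraph G u u g) (extendTop G u u g) v none).edges ↔
          G.tail e ≠ v ∧ G.head e ≠ v := by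
        simp only [reduceAt, Finset.mem_insert, reduceCtorEq, false_or]
        rw [Finset.mem_filter]
        simp [extendTop, extendGraph]
      rw [h3]
      simp only [hXdef, Finset.mem_union, Finset.some_mem_insertNone, Finset.mem_map,
        Function.Embedding.some_apply, Option.some.injEq, exists_eq_right, h2]
      tauto
  have hdX : Disjoint (edgeSpan (extendGraph G u u g) X.edges).verts
      (edgeSpan (extendGraph G u u g) (R.map Function.Embedding.some)).verts := by
    rw [← hXs, edgeSpan_map_verts]
    exact hdC.mono_left (by rw [h.union_verts hY.base_mem]; exact Finset.subset_insert _ _)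
  have hα := h.alpha_extend_le_alpha_union (j := j) hk hf hY hXY hXn hg1 hg
  have hCe := h.excess_union hY.base_mem hY.apex_notMem
  replace hRc : (R.card : ℤ) = fCount G k j R := hRc
  rw [hEdges, fCount_union hdX, fCount_of_connected ⟨none, hXn⟩ (hXs ▸ hXc), ← hXs,
    fCount_extend hk h.base_free, ← hRc,
    Finset.card_union_of_disjoint (disjoint_of_disjoint_verts hdX), Finset.card_map]
  have hXv : X.verts.card = Y.verts.card := rfl
  have hXe : X.edges.card = Y.edges.card + 1 := Finset.card_insertNone _
  unfold connBound at hCc ⊢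
  have hCv : (Y.union (tripleSpan G s)).verts.card = Y.verts.card + 1 := by
    rw [h.union_verts hY.base_mem, Finset.card_insert_of_notMem hY.apex_notMem]
  unfold excess at hCe
  rw [hXv, hXe]
  push_cast
  omega

omit hk [IsCyclic Γ] [Finite Γ] in
theorem isGainGraphOn_reduceAt (hG : IsGainGraphOn G (⊤ : Subgraph G)) (hg1 : g ≠ 1)
    (hb : ¬ Blocked G j v u g) : IsGainGraphOn (extendGraph G u u g)
      (reduceAt (extendGraph G u u g) (extendTop G u u g) v none) := by
  have hu := h.base_free
  have hno : ∀ e, G.tail e = u → G.head e = u → G.gain e ≠ g ∧ G.gain e ≠ g⁻¹ := fun e ht hh =>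
    not_or.1 fun h' => hb (blocked_of_loop h.ne hu ht hh h')
  have hm : ∀ e, e ∈ (⊤ : Subgraph G).edges := Finset.mem_univ
  refine ⟨?_, ?_, ?_, ?_, ?_, ?_⟩
  · exact_mod_cast fixedVerts_card_le (G := extendGraph G u u g) hf _
  · rintro (_ | e) - (_ | f) - hef ht hh
    · exact absurd rfl hef
    · exact (hno f ht.symm hh.symm).1.symm
    · exact (hno e ht hh).1
    · exact hG.same_dir e (hm e) f (hm f) (fun h' => hef (congrArg some h')) ht hh
  · rintro (_ | e) - (_ | f) - hef ht hh
    · exact absurd rfl hef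
    · exact fun h' => (hno f hh.symm ht.symm).2 (inv_eq_iff_eq_inv.1 h'.symm)
    · exact (hno e ht hh).2
    · exact hG.opp_dir e (hm e) f (hm f) (fun h' => hef (congrArg some h')) ht hh
  · rintro (_ | e) - ht
    · exact hu
    · exact hG.fixed_not_loop e (hm e) ht
  · rintro (_ | e) - (_ | f) - hef hfix
    · exact absurd rfl hef
    · exact absurd (or_self_iff.1 hfix) hu
    · intro h'
      have h1 : G.tail e ∈ ({u, u} : Finset V) := h' ▸ Finset.mem_insert_self _ _
      have h2 : G.head e ∈ ({u, u} : Finset V) :=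
        h' ▸ Finset.mem_insert_of_mem (Finset.mem_singleton_self _)
      simp only [Finset.mem_insert, Finset.mem_singleton, or_self] at h1 h2
      rcases hfix with hfix | hfix
      · exact hu (h1 ▸ hfix)
      · exact hu (h2 ▸ hfix)
    · exact hG.fixed_not_parallel e (hm e) f (hm f) (fun h' => hef (congrArg some h')) hfix
  · rintro (_ | e) - ht
    · exact hg1
    · exact hG.loop_gain e (hm e) ht

theorem admissibleOneReductionExists (hG : IsGainGraphOn G (⊤ : Subgraph G))
    (ht : GainTightKJ G k j (⊤ : Subgraph G)) : AdmissibleOneReductionExists G k j v := by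
  obtain ⟨p, q, hpq, hb⟩ := h.exists_not_blocked hk hf ht.1
  have hg1 := h.loopGain_ne_one hpq
  refine ⟨u, u, loopGain G s p q, ⟨?_, h.ne, h.ne, someStep (s p), someStep (flipStep (s q)),
    ?_, ?_, ?_, ?_, ?_, ?_, ?_, ?_⟩, h.isGainGraphOn_reduceAt hf hG hg1 hb,
    h.tight_reduceAt hk hf ht hg1 hb ⟨p, q, rfl⟩⟩
  · simp [extendTop]
  · simp [extendTop, someStep]
  · simp [extendTop, someStep]
  · exact fun h' => hpq (h.edge_inj (Option.some_injective _ h'))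
  · exact h.end_eq p
  · exact (stepStart_flipStep (G := G) (s q)).trans (h.end_eq q)
  · exact (h.start_eq p).symm
  · exact ((stepEnd_flipStep (G := G) (s q)).trans (h.start_eq q)).symm
  · exact congrArg (stepGain G (s p) * ·) (stepGain_flipStep (G := G) (s q)).symm

end PendantTriple

end Admissible

section OneNeighbor

variable {V E Γ : Type} [DecidableEq V] [DecidableEq E] [Fintype V] [Fintype E] [CommGroup Γ]
  {G : GainedGraph V E Γ} {v u : V}

/-- A free vertex of degree three with no loop and a single neighbour forms a pendant triple. -/
theorem exists_pendantTriple (hG : IsGainGraphOn G (⊤ : Subgraph G)) (hv : v ∉ G.fixed)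
    (hdeg : degree G (⊤ : Subgraph G) v = 3) (hloop : ¬ HasLoopAt G (⊤ : Subgraph G) v)
    (hnbr : neighbors G (⊤ : Subgraph G) v = {u}) : ∃ s, PendantTriple G v u s := by
  have hm : ∀ e, e ∈ (⊤ : Subgraph G).edges := Finset.mem_univ
  have hends : ∀ e, G.tail e = v ∧ G.head e = u ∨ G.head e = v ∧ G.tail e = u ∨
      (G.tail e ≠ v ∧ G.head e ≠ v) := by
    intro e
    by_cases h1 : G.tail e = v
    · refine Or.inl ⟨h1, Finset.mem_singleton.1 (hnbr ▸ Finset.mem_union_left _ ?_)⟩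
      exact Finset.mem_image_of_mem _ (Finset.mem_filter.2 ⟨hm e, h1⟩)
    by_cases h2 : G.head e = v
    · refine Or.inr (Or.inl ⟨h2, Finset.mem_singleton.1 (hnbr ▸ Finset.mem_union_right _ ?_)⟩)
      exact Finset.mem_image_of_mem _ (Finset.mem_filter.2 ⟨hm e, h2⟩)
    exact Or.inr (Or.inr ⟨h1, h2⟩)
  have hcard : (Finset.univ.filter fun e => G.tail e = v ∨ G.head e = v).card = 3 := by
    rw [Finset.filter_or, Finset.card_union_of_disjoint]
    · exact hdeg
    · rw [Finset.disjoint_filter]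
      exact fun e _ h1 h2 => hloop ⟨e, hm e, h1, h2⟩
  set φ := Finset.equivFinOfCardEq hcard
  set a : Fin 3 → E := fun i => φ.symm i with ha
  have hinj : Function.Injective a := Subtype.val_injective.comp φ.symm.injective
  have hav : ∀ i, G.tail (a i) = v ∨ G.head (a i) = v := fun i =>
    (Finset.mem_filter.1 (φ.symm i).2).2
  have huv : u ≠ v := by
    rintro rfl
    rcases hends (a 0) with h | ⟨h1, h2⟩ | ⟨h1, h2⟩
    · exact hloop ⟨_, hm _, h⟩
    · exact hloop ⟨_, hm _, h2, h1⟩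
    · exact (hav 0).elim h1 h2
  have htri : ∀ i, G.tail (a i) = v ∧ G.head (a i) = u ∨ G.tail (a i) = u ∧ G.head (a i) = v := by
    intro i
    rcases hends (a i) with h | ⟨h1, h2⟩ | ⟨h1, h2⟩
    · exact Or.inl h
    · exact Or.inr ⟨h2, h1⟩
    · exact ((hav i).elim h1 h2).elim
  refine ⟨fun i => (a i, decide (G.tail (a i) = u)), huv, ?_, hv, ?_, ?_, hinj, ?_, ?_⟩
  · intro hu
    have hset : ∀ i, ({G.tail (a i), G.head (a i)} : Finset V) = {u, v} := by
      intro i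
      rcases htri i with ⟨h1, h2⟩ | ⟨h1, h2⟩ <;> rw [h1, h2]
      exact Finset.pair_comm _ _
    refine hG.fixed_not_parallel _ (hm (a 0)) _ (hm (a 1)) (hinj.ne (by decide)) ?_
      ((hset 0).trans (hset 1).symm)
    rcases htri 0 with ⟨h1, h2⟩ | ⟨h1, h2⟩
    · exact Or.inr (h2 ▸ hu)
    · exact Or.inl (h1 ▸ hu)
  · intro i
    rcases htri i with ⟨h1, h2⟩ | ⟨h1, h2⟩ <;> simp [stepStart, h1, h2, huv.symm]
  · intro i
    rcases htri i with ⟨h1, h2⟩ | ⟨h1, h2⟩ <;> simp [stepEnd, h1, h2, huv.symm]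
  · intro p q hpq
    by_contra hne
    have hne' := hinj.ne hne
    have same := hG.same_dir _ (hm (a p)) _ (hm (a q)) hne'
    have opp := hG.opp_dir _ (hm (a p)) _ (hm (a q)) hne'
    rcases htri p with ⟨h1, h2⟩ | ⟨h1, h2⟩ <;> rcases htri q with ⟨h3, h4⟩ | ⟨h3, h4⟩ <;>
      simp only [h1, h2, h3, h4, stepGain, huv.symm, decide_true, decide_false, if_true,
        Bool.false_eq_true, if_false, inv_inj] at hpq same opp
    · exact same trivial trivial hpq
    · exact opp trivial trivial (inv_eq_iff_eq_inv.1 hpq)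
    · exact opp trivial trivial hpq
    · exact same trivial trivial hpq
  · intro e he
    refine ⟨φ ⟨e, Finset.mem_filter.2 ⟨Finset.mem_univ _, he⟩⟩, ?_⟩
    simp [ha]

end OneNeighbor

/-- Let `(G,ψ)` be a `ℤ_k^j`-gain tight `Γ`-gain graph (`Γ` cyclic of
order `k ≥ 4`, `2 ≤ j ≤ k−2`) with a free vertex `v` of degree `3`, no loop, and exactly
one neighbour `u`.  Then there is an admissible 1-reduction at `v`. -/
theorem admissible_one_reduction_one_neighbor {V E : Type}
    [DecidableEq V] [DecidableEq E] [Fintype V] [Fintype E]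
    (k j : ℕ) (hk : 4 ≤ k) (hj2 : 2 ≤ j) (hjk : j ≤ k - 2)
    (G : GainedGraph V E (Multiplicative (ZMod k)))
    (hG : IsGainGraphOn G (⊤ : Subgraph G))
    (htight : GainTightKJ G k j (⊤ : Subgraph G))
    (v : V) (hvfree : v ∉ G.fixed)
    (hdeg : degree G (⊤ : Subgraph G) v = 3)
    (hloop : ¬ HasLoopAt G (⊤ : Subgraph G) v)
    (u : V) (hnbr : neighbors G (⊤ : Subgraph G) v = {u}) :
    AdmissibleOneReductionExists G k j v := by
  have : NeZero k := ⟨by omega⟩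
  obtain ⟨s, h⟩ := exists_pendantTriple hG hvfree hdeg hloop hnbr
  have hcard : Nat.card (Multiplicative (ZMod k)) = k :=
    (Nat.card_congr Multiplicative.toAdd).trans (Nat.card_zmod k)
  have hf : G.fixed.card ≤ 1 :=
    (Finset.card_le_card fun x hx =>
      Finset.mem_inter.2 ⟨Finset.mem_univ x, hx⟩).trans hG.fixed_card
  exact h.admissibleOneReductionExists hcard hf hG htight

end GR
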